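/- arXiv:2601.09643 — 3 statements merged into one kernel-verified Lean document; each statement's English description precedes it below -/
import Mathlib

section
/- Let G be a locally finite group. For m ≥ 1 let G[m] denote the fully characteristic subgroup of G generated by the set {x ∈ G : x^m = e}. If for every positive integer n the Addition Theorem holds for G[n!] for endomorphisms (i.e. AT(G[n!], ψ, K) holds for every endomorphism ψ of G[n!] and every ψ-invariant normal subgroup K of G[n!]), then the Addition Theorem holds for G for endomorphisms: for every endomorphism φ of G and every φ-invariant normal subgroup H of G, h(φ) = h(φ↾_H) + h(φ̄), where φ̄ is the endomorphism induced by φ on G/H. -/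
open scoped Pointwise ENNReal

/-- A group is *locally finite* if every finitely generated subgroup is finite. -/
def IsLocallyFinite (G : Type*) [Group G] : Prop :=
  ∀ S : Set G, S.Finite → (Subgroup.closure S : Set G).Finite

namespace AlgEntropy

variable {G : Type*} [Group G]

/-- `entTraj φ F n` is the `n`-th trajectory `T_n(φ,F) = F·φ(F)···φ^{n-1}(F)`
(with `T_0 = {1}`). -/
def entTraj (φ : G →* G) (F : Set G) : ℕ → Set G
  | 0 => {1}
  | n + 1 => entTraj φ F n * (⇑φ)^[n] '' F

/-- The algebraic entropy of `φ` with respect to a subgroup `F`: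
`H(φ,F) = lim_n (1/n)·log|T_n(φ,F)|` (the limit exists when `G` is locally
finite and `F` is finite, and then it coincides with this `limsup`). -/
noncomputable def entH (φ : G →* G) (F : Subgroup G) : ℝ :=
  Filter.limsup (fun n : ℕ => Real.log (entTraj φ (F : Set G) n).ncard / n) Filter.atTop

/-- The algebraic entropy `h(φ) = sup { H(φ,F) : F ≤ G finite }`, valued in `[0,∞]`. -/
noncomputable def algEnt (φ : G →* G) : ℝ≥0∞ :=
  ⨆ (F : Subgroup G) (_ : (F : Set G).Finite), ENNReal.ofReal (entH φ F)

/-- The restriction of an endomorphism `φ` to a `φ`-invariant subgroup `H`. -/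
def endRestrict (φ : G →* G) (H : Subgroup G) (hH : H ≤ H.comap φ) : H →* H :=
  (φ.domRestrict H).codRestrict H (fun x => hH x.2)

/-- The entropy of the endomorphism induced by `φ` on the quotient `G ⧸ H`. -/
noncomputable def entQuot (φ : G →* G) (H : Subgroup G) (hN : H.Normal)
    (hH : H ≤ H.comap φ) : ℝ≥0∞ :=
  letI := hN
  algEnt (QuotientGroup.map H H φ hH)

/-- The Addition Theorem `AT(G,φ,H)`:
`h(φ) = h(φ↾_H) + h(φ̄)` where `φ̄` is induced by `φ` on `G ⧸ H`. -/
def AT (φ : G →* G) (H : Subgroup G) (hN : H.Normal) (hH : H ≤ H.comap φ) : Prop :=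
  algEnt φ = algEnt (endRestrict φ H hH) + entQuot φ H hN hH

lemma commutator_le_comap (φ : G →* G) :
    commutator G ≤ (commutator G).comap φ := by
  rw [← Subgroup.map_le_iff_le_comap]
  calc Subgroup.map φ (commutator G) = ⁅Subgroup.map φ ⊤, Subgroup.map φ ⊤⁆ :=
        Subgroup.map_commutator ⊤ ⊤ φ
    _ ≤ commutator G := Subgroup.commutator_mono le_top le_top

lemma normal_of_le_center {N : Subgroup G} (h : N ≤ Subgroup.center G) : N.Normal := by
  constructor
  intro n hn g
  have hc := Subgroup.mem_center_iff.mp (h hn) g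
  have : g * n * g⁻¹ = n := by
    rw [hc]; group
  rwa [this]

lemma center_le_comap_equiv (φ : G ≃* G) :
    Subgroup.center G ≤ (Subgroup.center G).comap φ.toMonoidHom := by
  intro x hx
  simp only [Subgroup.mem_comap]
  refine Subgroup.mem_center_iff.mpr fun g => ?_
  have hg : φ (φ.symm g) = g := φ.apply_symm_apply g
  calc g * φ x = φ (φ.symm g) * φ x := by rw [hg]
    _ = φ (φ.symm g * x) := by rw [map_mul]
    _ = φ (x * φ.symm g) := by rw [Subgroup.mem_center_iff.mp hx (φ.symm g)]
    _ = φ x * g := by rw [map_mul, hg]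

lemma lowerCentralSeries_le_comap (φ : G →* G) (n : ℕ) :
    Subgroup.lowerCentralSeries (⊤ : Subgroup G) n ≤ (Subgroup.lowerCentralSeries (⊤ : Subgroup G) n).comap φ := by
  rw [← Subgroup.map_le_iff_le_comap]
  induction n with
  | zero => exact le_top
  | succ n ih =>
      show Subgroup.map φ ⁅Subgroup.lowerCentralSeries (⊤ : Subgroup G) n, ⊤⁆ ≤
        ⁅Subgroup.lowerCentralSeries (⊤ : Subgroup G) n, ⊤⁆
      rw [Subgroup.map_commutator]
      exact Subgroup.commutator_mono ih le_top

lemma upperCentralSeries_le_comap (φ : G ≃* G) (n : ℕ) :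
    upperCentralSeries G n ≤ (upperCentralSeries G n).comap φ.toMonoidHom := by
  have := comap_upperCentralSeries φ n
  -- `(upperCentralSeries G n).comap φ = upperCentralSeries G n`
  exact le_of_eq this.symm

end AlgEntropy

/-- For `m ≥ 1`, `G[m]` is the (fully characteristic) subgroup of `G` generated by
`{x ∈ G : x^m = 1}`. -/
def boundedPart (G : Type*) [Group G] (m : ℕ) : Subgroup G :=
  Subgroup.closure {x : G | x ^ m = 1}

namespace AlgEntropy

lemma image_entTraj {A B : Type*} [Group A] [Group B] (ψ : A →* A) (φ : B →* B)
    (f : A →* B) (hc : ∀ x, f (ψ x) = φ (f x)) (F : Set A) (n : ℕ) :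
    f '' entTraj ψ F n = entTraj φ (f '' F) n := by
  induction n with
  | zero => simp [entTraj]
  | succ n ih =>
    have hs : Function.Semiconj f ψ φ := hc
    have h2 := hs.iterate_right n
    simp only [entTraj]
    rw [Set.image_mul, ih, ← Set.image_comp, ← Set.image_comp, h2.comp_eq]

lemma entH_map {A B : Type*} [Group A] [Group B] (ψ : A →* A) (φ : B →* B)
    (f : A →* B) (hf : Function.Injective f) (hc : ∀ x, f (ψ x) = φ (f x)) (F : Subgroup A) :
    entH φ (F.map f) = entH ψ F := by
  unfold entH
  congr 1
  funext n
  rw [Subgroup.coe_map, ← image_entTraj ψ φ f hc, Set.ncard_image_of_injective _ hf]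

lemma entH_le_algEnt {A B : Type*} [Group A] [Group B] (ψ : A →* A) (φ : B →* B)
    (f : A →* B) (hf : Function.Injective f) (hc : ∀ x, f (ψ x) = φ (f x)) (F : Subgroup B)
    (hF : (F : Set B).Finite) (hr : F ≤ f.range) :
    ENNReal.ofReal (entH φ F) ≤ algEnt ψ := by
  have h1 : (F.comap f).map f = F := Subgroup.map_comap_eq_self hr
  rw [← h1, entH_map ψ φ f hf hc]
  refine le_iSup₂_of_le (F.comap f) ?_ le_rfl
  rw [Subgroup.coe_comap]
  exact Set.Finite.preimage (f := f) hf.injOn hF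

lemma algEnt_le_of_range {A A' B : Type*} [Group A] [Group A'] [Group B]
    (ψ : A →* A) (ψ' : A' →* A') (φ : B →* B)
    (f : A →* B) (hf : Function.Injective f) (hc : ∀ x, f (ψ x) = φ (f x))
    (f' : A' →* B) (hf' : Function.Injective f') (hc' : ∀ x, f' (ψ' x) = φ (f' x))
    (hr : f.range ≤ f'.range) : algEnt ψ ≤ algEnt ψ' := by
  refine iSup₂_le fun F hF => ?_
  rw [← entH_map ψ φ f hf hc]
  refine entH_le_algEnt ψ' φ f' hf' hc' _ ?_ ((Subgroup.map_le_range f F).trans hr)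
  exact hF.image f

/-- Entropy is continuous along a chain of invariant subgroups. -/
lemma algEnt_chain {A : ℕ → Type*} {B : Type*} [∀ n, Group (A n)] [Group B]
    (ψ : ∀ n, A n →* A n) (φ : B →* B)
    (f : ∀ n, A n →* B) (hf : ∀ n, Function.Injective (f n))
    (hc : ∀ n x, f n (ψ n x) = φ (f n x))
    (hm : Monotone fun n => (f n).range) (hx : ∀ x, ∃ n, x ∈ (f n).range) :
    algEnt φ = ⨆ n, algEnt (ψ n) ∧ Monotone fun n => algEnt (ψ n) := by
  refine ⟨le_antisymm ?_ ?_, ?_⟩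
  · refine iSup₂_le fun F hF => ?_
    have : ∃ n, F ≤ (f n).range := by
      choose g hg using hx
      obtain ⟨N, hN⟩ := (hF.image g).bddAbove
      exact ⟨N, fun x hxF => hm (hN (Set.mem_image_of_mem g hxF)) (hg x)⟩
    obtain ⟨n, hn⟩ := this
    exact (entH_le_algEnt (ψ n) φ (f n) (hf n) (hc n) F hF hn).trans
      (le_iSup (fun n => algEnt (ψ n)) n)
  · refine iSup_le fun n => ?_
    refine algEnt_le_of_range (ψ n) φ φ (f n) (hf n) (hc n) (MonoidHom.id B)
      Function.injective_id (fun _ => rfl) ?_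
    intro x _
    exact ⟨x, rfl⟩
  · intro n m hnm
    exact algEnt_le_of_range (ψ n) (ψ m) φ (f n) (hf n) (hc n) (f m) (hf m) (hc m) (hm hnm)

lemma boundedPart_le_comap {G : Type*} [Group G] (φ : G →* G) (m : ℕ) :
    boundedPart G m ≤ (boundedPart G m).comap φ := by
  refine (Subgroup.closure_le _).2 fun x hx => ?_
  refine Subgroup.subset_closure ?_
  have hx' : x ^ m = 1 := hx
  show φ x ^ m = 1
  rw [← map_pow, hx', map_one]

lemma boundedPart_mono {G : Type*} [Group G] {m n : ℕ} (h : m ∣ n) :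
    boundedPart G m ≤ boundedPart G n := by
  refine Subgroup.closure_mono fun x hx => ?_
  obtain ⟨k, rfl⟩ := h
  have hx' : x ^ m = 1 := hx
  show x ^ (m * k) = 1
  rw [pow_mul, hx', one_pow]

lemma exists_mem_boundedPart {G : Type*} [Group G] (hG : IsLocallyFinite G) (x : G) :
    ∃ n : ℕ, x ∈ boundedPart G (Nat.factorial (n + 1)) := by
  have h := hG {x} (Set.finite_singleton x)
  rw [← Subgroup.zpowers_eq_closure] at h
  have h2 : IsOfFinOrder x := finite_zpowers.1 h
  refine ⟨orderOf x, Subgroup.subset_closure ?_⟩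
  exact orderOf_dvd_iff_pow_eq_one.1
    (Nat.dvd_factorial h2.orderOf_pos (Nat.le_succ _))

end AlgEntropy

/-- If `G` is locally finite and the Addition Theorem holds for
`G[n!]` for endomorphisms for every `n ≥ 1`, then the Addition Theorem holds for `G`
for endomorphisms. -/
theorem AT_of_boundedParts {G : Type*} [Group G] (hG : IsLocallyFinite G)
    (hATn : ∀ n : ℕ, 0 < n →
      ∀ (ψ : ↥(boundedPart G (Nat.factorial n)) →* ↥(boundedPart G (Nat.factorial n)))
        (K : Subgroup ↥(boundedPart G (Nat.factorial n))) (hK : K.Normal) (hKψ : K ≤ K.comap ψ),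
        AlgEntropy.AT ψ K hK hKψ)
    (φ : G →* G) (H : Subgroup G) (hN : H.Normal) (hH : H ≤ H.comap φ) :
    AlgEntropy.AT φ H hN hH := by
  have := hN
  let P : ℕ → Subgroup G := fun n => boundedPart G (Nat.factorial (n + 1))
  have hPm : Monotone P := fun n m h =>
    AlgEntropy.boundedPart_mono (Nat.factorial_dvd_factorial (Nat.succ_le_succ h))
  have hPx : ∀ x, ∃ n, x ∈ P n := AlgEntropy.exists_mem_boundedPart hG
  have hPc : ∀ n, P n ≤ (P n).comap φ := fun n => AlgEntropy.boundedPart_le_comap φ _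
  let ψ : ∀ n, P n →* P n := fun n => AlgEntropy.endRestrict φ (P n) (hPc n)
  let K : ∀ n, Subgroup (P n) := fun n => H.subgroupOf (P n)
  have hKn : ∀ n, (K n).Normal := fun n => inferInstance
  have hKc : ∀ n, K n ≤ (K n).comap (ψ n) := fun n x hx => hH (show (x : G) ∈ H from hx)
  have hAT : ∀ n, AlgEntropy.algEnt (ψ n) =
      AlgEntropy.algEnt (AlgEntropy.endRestrict (ψ n) (K n) (hKc n)) +
      AlgEntropy.algEnt (QuotientGroup.map (K n) (K n) (ψ n) (hKc n)) :=
    fun n => hATn (n + 1) n.succ_pos (ψ n) (K n) (hKn n) (hKc n)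
  -- the chain in `G`
  have h1 := AlgEntropy.algEnt_chain ψ φ (fun n => (P n).subtype)
    (fun n => (P n).subtype_injective) (fun n x => rfl)
    (by simpa using hPm) (by simpa using hPx)
  -- the chain in `H`
  let g : ∀ n, K n →* H := fun n =>
    ((P n).subtype.comp (K n).subtype).codRestrict H (fun x => x.2)
  have hgr : ∀ n (x : H), x ∈ (g n).range ↔ (x : G) ∈ P n := by
    intro n x
    constructor
    · rintro ⟨y, rfl⟩
      exact y.1.2
    · intro hx
      exact ⟨⟨⟨x, hx⟩, x.2⟩, rfl⟩
  have h2 := AlgEntropy.algEnt_chain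
    (fun n => AlgEntropy.endRestrict (ψ n) (K n) (hKc n)) (AlgEntropy.endRestrict φ H hH) g
    (fun n x y hxy => Subtype.ext (Subtype.ext (congrArg (fun z : H => (z : G)) hxy)))
    (fun n x => rfl)
    (fun n m hnm x hx => (hgr m x).2 (hPm hnm ((hgr n x).1 hx)))
    (fun x => (hPx x).imp fun n hn => (hgr n x).2 hn)
  -- the chain in `G ⧸ H`
  let q : ∀ n, (P n ⧸ K n) →* G ⧸ H := fun n =>
    QuotientGroup.map (K n) H (P n).subtype (fun x hx => hx)
  have hqr : ∀ n (x : G ⧸ H), x ∈ (q n).range ↔ ∃ y ∈ P n, (y : G ⧸ H) = x := by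
    intro n x
    constructor
    · rintro ⟨y, rfl⟩
      obtain ⟨z, rfl⟩ := QuotientGroup.mk_surjective y
      exact ⟨z, z.2, rfl⟩
    · rintro ⟨y, hy, rfl⟩
      exact ⟨((⟨y, hy⟩ : P n) : P n ⧸ K n), rfl⟩
  have h3 := AlgEntropy.algEnt_chain
    (fun n => QuotientGroup.map (K n) (K n) (ψ n) (hKc n)) (QuotientGroup.map H H φ hH) q
    (by
      intro n
      refine (injective_iff_map_eq_one _).2 fun y hy => ?_
      obtain ⟨z, rfl⟩ := QuotientGroup.mk_surjective y
      have hz : ((z : G) : G ⧸ H) = 1 := hy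
      exact (QuotientGroup.eq_one_iff z).2 ((QuotientGroup.eq_one_iff (z : G)).1 hz))
    (by
      intro n x
      obtain ⟨z, rfl⟩ := QuotientGroup.mk_surjective x
      rfl)
    (by
      intro n m hnm x hx
      obtain ⟨y, hy, rfl⟩ := (hqr n x).1 hx
      exact (hqr m _).2 ⟨y, hPm hnm hy, rfl⟩)
    (by
      intro x
      obtain ⟨y, rfl⟩ := QuotientGroup.mk_surjective x
      exact (hPx y).imp fun n hn => (hqr n _).2 ⟨y, hn, rfl⟩)
  show AlgEntropy.algEnt φ = AlgEntropy.algEnt (AlgEntropy.endRestrict φ H hH) +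
    AlgEntropy.algEnt (QuotientGroup.map H H φ hH)
  rw [h1.1, h2.1, h3.1, ENNReal.iSup_add_iSup_of_monotone h2.2 h3.2]
  exact iSup_congr hAT
end

section
/- Let G be a torsion ω-hypercentral group (i.e. every element of G has finite order and G = ⋃_{n∈ℕ} Z_n(G), where Z_n(G) denotes the upper central series) and let φ be an automorphism of G. Then for every φ-stable normal subgroup H of G, h(φ) = h(φ↾_H) + h(φ̄), where φ̄ is the automorphism induced by φ on G/H. -/
open scoped Pointwise ENNReal

namespace ATproof

open AlgEntropy Filter Topology

universe u v w

section basics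

variable {G : Type u} [Group G]

/-- Ordered product `f 0 · φ (f 1) ⋯ φ^{n-1} (f (n-1))`. -/
def pr (φ : G →* G) (f : ℕ → G) : ℕ → G
  | 0 => 1
  | n + 1 => pr φ f n * (⇑φ)^[n] (f n)

lemma pr_congr (φ : G →* G) {f g : ℕ → G} {n : ℕ} (h : ∀ j < n, f j = g j) :
    pr φ f n = pr φ g n := by
  induction n with
  | zero => rfl
  | succ n ih =>
    simp only [pr]
    rw [ih (fun j hj => h j (by omega)), h n (by omega)]

lemma iter_mul (φ : G →* G) (n : ℕ) (x y : G) :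
    (⇑φ)^[n] (x * y) = (⇑φ)^[n] x * (⇑φ)^[n] y := by
  induction n generalizing x y with
  | zero => rfl
  | succ n ih => simp only [Function.iterate_succ_apply, map_mul, ih]

lemma iter_one (φ : G →* G) (n : ℕ) : (⇑φ)^[n] 1 = 1 := by
  induction n with
  | zero => rfl
  | succ n ih => simp only [Function.iterate_succ_apply, map_one, ih]

lemma pr_add (φ : G →* G) (f : ℕ → G) (i k : ℕ) :
    pr φ f (i + k) = pr φ f i * (⇑φ)^[i] (pr φ (fun j => f (i + j)) k) := by
  induction k with
  | zero => simp [pr, iter_one]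
  | succ k ih =>
    rw [← Nat.add_assoc]
    simp only [pr]
    rw [ih, iter_mul, mul_assoc, ← Function.iterate_add_apply]

lemma pr_succ' (φ : G →* G) (f : ℕ → G) (k : ℕ) :
    pr φ f (k + 1) = f 0 * φ (pr φ (fun j => f (j + 1)) k) := by
  rw [Nat.add_comm k 1, pr_add]
  simp [pr, Nat.add_comm]

lemma pr_ext (φ : G →* G) {f g : ℕ → G} {a b : ℕ} (hab : a ≤ b) (h : pr φ f a = pr φ g a)
    (h1 : ∀ j, a ≤ j → f j = g j) : pr φ f b = pr φ g b := by
  obtain ⟨l, rfl⟩ := Nat.exists_eq_add_of_le hab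
  rw [pr_add φ f a, pr_add φ g a, h]
  congr 2
  exact pr_congr φ (fun j _ => h1 _ (by omega))

lemma pr_ext_cancel (φ : G →* G) {f g : ℕ → G} {a b : ℕ} (hab : a ≤ b)
    (h : pr φ f b = pr φ g b)
    (h1 : ∀ j, a ≤ j → f j = g j) : pr φ f a = pr φ g a := by
  obtain ⟨l, rfl⟩ := Nat.exists_eq_add_of_le hab
  rw [pr_add φ f a, pr_add φ g a, pr_congr φ (f := fun j => f (a + j)) (g := fun j => g (a + j))
    (fun j _ => h1 _ (by omega))] at h
  exact mul_right_cancel h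

lemma mem_traj {φ : G →* G} {F : Subgroup G} {n : ℕ} {x : G} :
    x ∈ entTraj φ (F : Set G) n ↔ ∃ f : ℕ → G, (∀ j, f j ∈ F) ∧ pr φ f n = x := by
  induction n generalizing x with
  | zero =>
    simp only [entTraj, pr, Set.mem_singleton_iff]
    exact ⟨fun h => ⟨fun _ => 1, fun _ => F.one_mem, h.symm⟩, fun ⟨_, _, h⟩ => h.symm⟩
  | succ n ih =>
    simp only [entTraj, pr]
    constructor
    · rintro ⟨a, ha, b, ⟨y, hy, rfl⟩, rfl⟩
      obtain ⟨f, hf, rfl⟩ := ih.1 ha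
      refine ⟨Function.update f n y, ?_, ?_⟩
      · intro j
        by_cases h : j = n
        · subst h; simpa using hy
        · simpa [h] using hf j
      · rw [pr_congr φ (g := f)]
        · simp
        · intro j hj
          simp [Nat.ne_of_lt hj]
    · rintro ⟨f, hf, rfl⟩
      exact ⟨_, ih.2 ⟨f, hf, rfl⟩, _, ⟨f n, hf n, rfl⟩, rfl⟩

lemma traj_finite {φ : G →* G} {F : Subgroup G} (hF : (F : Set G).Finite) (n : ℕ) :
    (entTraj φ (F : Set G) n).Finite := by
  induction n with
  | zero => exact Set.finite_singleton _
  | succ n ih => exact ih.mul (hF.image _)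

lemma one_mem_traj (φ : G →* G) (F : Subgroup G) (n : ℕ) : (1 : G) ∈ entTraj φ (F : Set G) n := by
  refine mem_traj.2 ⟨fun _ => 1, fun _ => F.one_mem, ?_⟩
  induction n with
  | zero => rfl
  | succ n ih => simp [pr, ih, iter_one]

lemma traj_ncard_pos {φ : G →* G} {F : Subgroup G} (hF : (F : Set G).Finite) (n : ℕ) :
    0 < (entTraj φ (F : Set G) n).ncard :=
  (Set.ncard_pos (traj_finite hF n)).2 ⟨1, one_mem_traj φ F n⟩

lemma traj_mono {φ : G →* G} {F F' : Subgroup G} (h : F ≤ F') (n : ℕ) :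
    entTraj φ (F : Set G) n ⊆ entTraj φ (F' : Set G) n := by
  intro x hx
  obtain ⟨f, hf, rfl⟩ := mem_traj.1 hx
  exact mem_traj.2 ⟨f, fun j => h (hf j), rfl⟩

lemma traj_add {φ : G →* G} {F : Subgroup G} (n m : ℕ) :
    entTraj φ (F : Set G) (n + m) ⊆
      entTraj φ (F : Set G) n * (⇑φ)^[n] '' entTraj φ (F : Set G) m := by
  intro x hx
  obtain ⟨f, hf, rfl⟩ := mem_traj.1 hx
  rw [pr_add]
  exact ⟨_, mem_traj.2 ⟨f, hf, rfl⟩, _, ⟨_, mem_traj.2 ⟨_, fun j => hf _, rfl⟩, rfl⟩, rfl⟩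

lemma ncard_mul_le' (s t : Set G) : (s * t).ncard ≤ s.ncard * t.ncard := by
  have h := Set.natCard_mul_le (s := s) (t := t)
  rwa [Nat.card_coe_set_eq, Nat.card_coe_set_eq, Nat.card_coe_set_eq] at h

lemma entH_tendsto {φ : G →* G} {F : Subgroup G} (hF : (F : Set G).Finite) :
    Tendsto (fun n : ℕ => Real.log (entTraj φ (F : Set G) n).ncard / n) atTop
      (𝓝 (entH φ F)) := by
  have hsub : Subadditive (fun n : ℕ => Real.log (entTraj φ (F : Set G) n).ncard) := by
    intro m n
    have hm := traj_ncard_pos (φ := φ) hF m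
    have hn := traj_ncard_pos (φ := φ) hF n
    have hmn := traj_ncard_pos (φ := φ) hF (m + n)
    rw [← Real.log_mul (by positivity) (by positivity)]
    apply Real.log_le_log (by exact_mod_cast hmn)
    have h1 : (entTraj φ (F : Set G) (m + n)).ncard ≤ _ :=
      Set.ncard_le_ncard (traj_add m n) ((traj_finite hF m).mul ((traj_finite hF n).image _))
    have h2 := h1.trans (ncard_mul_le' _ _)
    have h3 := h2.trans (Nat.mul_le_mul_left _ (Set.ncard_image_le (traj_finite hF n)))
    exact_mod_cast h3
  have hb : BddBelow (Set.range fun n : ℕ => Real.log (entTraj φ (F : Set G) n).ncard / n) := by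
    refine ⟨0, ?_⟩
    rintro _ ⟨n, rfl⟩
    positivity
  have := hsub.tendsto_lim hb
  have h2 := this.limsup_eq
  unfold entH
  rw [h2]
  exact this

lemma entH_nonneg {φ : G →* G} {F : Subgroup G} (hF : (F : Set G).Finite) : 0 ≤ entH φ F :=
  ge_of_tendsto' (entH_tendsto hF) (fun n => by positivity)

lemma entH_mono {φ : G →* G} {F F' : Subgroup G} (hF' : (F' : Set G).Finite) (h : F ≤ F') :
    entH φ F ≤ entH φ F' := by
  have hF : (F : Set G).Finite := hF'.subset h
  refine le_of_tendsto_of_tendsto' (entH_tendsto hF) (entH_tendsto hF') (fun n => ?_)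
  have := traj_ncard_pos (φ := φ) hF n
  have h2 := Set.ncard_le_ncard (traj_mono (φ := φ) h n) (traj_finite hF' n)
  gcongr

lemma entH_le_algEnt {φ : G →* G} {F : Subgroup G} (hF : (F : Set G).Finite) :
    ENNReal.ofReal (entH φ F) ≤ algEnt φ :=
  le_iSup₂_of_le (f := fun (F : Subgroup G) (_ : (F : Set G).Finite) =>
    ENNReal.ofReal (entH φ F)) F hF le_rfl

lemma pr_map {Q : Type v} [Group Q] {φ : G →* G} {ψ : Q →* Q} {p : G →* Q}
    (h : ∀ x, p (φ x) = ψ (p x)) (f : ℕ → G) (n : ℕ) :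
    p (pr φ f n) = pr ψ (fun j => p (f j)) n := by
  induction n with
  | zero => simp [pr]
  | succ n ih =>
    simp only [pr, map_mul, ih]
    congr 1
    exact (Function.Semiconj.iterate_right (f := p) h n) (f n)

lemma traj_map {Q : Type v} [Group Q] {φ : G →* G} {ψ : Q →* Q} {p : G →* Q}
    (h : ∀ x, p (φ x) = ψ (p x)) (F : Subgroup G) (n : ℕ) :
    entTraj ψ ((F.map p : Subgroup Q) : Set Q) n = p '' entTraj φ (F : Set G) n := by
  ext x
  constructor
  · intro hx
    obtain ⟨f, hf, rfl⟩ := mem_traj.1 hx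
    choose g hg hgf using fun j => Subgroup.mem_map.1 (hf j)
    refine ⟨pr φ g n, mem_traj.2 ⟨g, hg, rfl⟩, ?_⟩
    rw [pr_map h]
    simp [hgf]
  · rintro ⟨y, hy, rfl⟩
    obtain ⟨f, hf, rfl⟩ := mem_traj.1 hy
    rw [pr_map h]
    exact mem_traj.2 ⟨_, fun j => Subgroup.mem_map_of_mem p (hf j), rfl⟩

lemma map_finite {Q : Type v} [Group Q] (p : G →* Q) {F : Subgroup G} (hF : (F : Set G).Finite) :
    ((F.map p : Subgroup Q) : Set Q).Finite := by
  rw [Subgroup.coe_map]; exact hF.image _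

lemma entH_map {Q : Type v} [Group Q] {φ : G →* G} {ψ : Q →* Q} {p : G →* Q}
    (h : ∀ x, p (φ x) = ψ (p x)) (hp : Function.Injective p) (F : Subgroup G) :
    entH ψ (F.map p) = entH φ F := by
  unfold entH
  congr 1
  ext n
  rw [traj_map h, Set.ncard_image_of_injective _ hp]

lemma algEnt_mono {Q : Type v} [Group Q] {φ : G →* G} {ψ : Q →* Q} {p : G →* Q}
    (h : ∀ x, p (φ x) = ψ (p x)) (hp : Function.Injective p) : algEnt φ ≤ algEnt ψ := by
  refine iSup₂_le fun F hF => ?_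
  rw [← entH_map h hp]
  exact entH_le_algEnt (map_finite p hF)

end basics

section central

variable {G : Type u} [Group G]

lemma iter_mem {φ : G →* G} {C : Subgroup G} (hφ : ∀ x ∈ C, φ x ∈ C) (n : ℕ) {x : G}
    (hx : x ∈ C) : (⇑φ)^[n] x ∈ C := by
  induction n generalizing x with
  | zero => exact hx
  | succ n ih => exact ih (hφ x hx)

lemma pr_mem {φ : G →* G} {C : Subgroup G} (hφ : ∀ x ∈ C, φ x ∈ C) {f : ℕ → G}
    (hf : ∀ j, f j ∈ C) (n : ℕ) : pr φ f n ∈ C := by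
  induction n with
  | zero => exact C.one_mem
  | succ n ih => exact C.mul_mem ih (iter_mem hφ n (hf n))

lemma comm_of_mem {C : Subgroup G} (hC : C ≤ Subgroup.center G) {x : G} (hx : x ∈ C) (y : G) :
    y * x = x * y := Subgroup.mem_center_iff.1 (hC hx) y

lemma pr_mul {φ : G →* G} {C : Subgroup G} (hC : C ≤ Subgroup.center G) (hφ : ∀ x ∈ C, φ x ∈ C)
    (f : ℕ → G) {g : ℕ → G} (hg : ∀ j, g j ∈ C) (n : ℕ) :
    pr φ (fun j => f j * g j) n = pr φ f n * pr φ g n := by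
  induction n with
  | zero => simp [pr]
  | succ n ih =>
    simp only [pr, ih, iter_mul]
    have := comm_of_mem hC (pr_mem hφ hg n) ((⇑φ)^[n] (f n))
    rw [mul_assoc, mul_assoc, ← mul_assoc (pr φ g n), ← this, mul_assoc]

lemma pr_one (φ : G →* G) (n : ℕ) : pr φ (fun _ => 1) n = 1 := by
  induction n with
  | zero => rfl
  | succ n ih => simp [pr, ih, iter_one]

lemma pr_inv {φ : G →* G} {C : Subgroup G} (hC : C ≤ Subgroup.center G) (hφ : ∀ x ∈ C, φ x ∈ C)
    {g : ℕ → G} (hg : ∀ j, g j ∈ C) (n : ℕ) :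
    pr φ (fun j => (g j)⁻¹) n = (pr φ g n)⁻¹ := by
  have := pr_mul hC hφ g (g := fun j => (g j)⁻¹) (fun j => C.inv_mem (hg j)) n
  simp only [mul_inv_cancel, pr_one] at this
  exact (inv_eq_of_mul_eq_one_right this.symm).symm

lemma traj_mul_mem {φ : G →* G} {C E : Subgroup G} (hC : C ≤ Subgroup.center G)
    (hφ : ∀ x ∈ C, φ x ∈ C) (hE : E ≤ C) {n : ℕ} {x y : G} (hx : x ∈ entTraj φ (E : Set G) n)
    (hy : y ∈ entTraj φ (E : Set G) n) : x * y ∈ entTraj φ (E : Set G) n := by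
  obtain ⟨f, hf, rfl⟩ := mem_traj.1 hx
  obtain ⟨g, hg, rfl⟩ := mem_traj.1 hy
  rw [← pr_mul hC hφ f (fun j => hE (hg j))]
  exact mem_traj.2 ⟨_, fun j => E.mul_mem (hf j) (hg j), rfl⟩

lemma traj_inv_mem {φ : G →* G} {C E : Subgroup G} (hC : C ≤ Subgroup.center G)
    (hφ : ∀ x ∈ C, φ x ∈ C) (hE : E ≤ C) {n : ℕ} {x : G} (hx : x ∈ entTraj φ (E : Set G) n) :
    x⁻¹ ∈ entTraj φ (E : Set G) n := by
  obtain ⟨f, hf, rfl⟩ := mem_traj.1 hx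
  rw [← pr_inv hC hφ (fun j => hE (hf j))]
  exact mem_traj.2 ⟨_, fun j => E.inv_mem (hf j), rfl⟩

lemma traj_subset_of_le (φ : G →* G) (E : Subgroup G) {n m : ℕ} (h : n ≤ m) :
    entTraj φ (E : Set G) n ⊆ entTraj φ (E : Set G) m := by
  intro x hx
  obtain ⟨f, hf, rfl⟩ := mem_traj.1 hx
  refine mem_traj.2 ⟨fun j => if j < n then f j else 1, ?_, ?_⟩
  · intro j
    dsimp only
    split_ifs
    · exact hf j
    · exact E.one_mem
  · obtain ⟨k, rfl⟩ := Nat.exists_eq_add_of_le h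
    rw [pr_add]
    simp only [Nat.not_lt.2 (Nat.le_add_right _ _), if_false, pr_one, iter_one, mul_one]
    exact pr_congr φ (fun j hj => by simp [hj])

lemma iter_mem_traj (φ : G →* G) (E : Subgroup G) {n i : ℕ} (h : i < n) {x : G} (hx : x ∈ E) :
    (⇑φ)^[i] x ∈ entTraj φ (E : Set G) n := by
  apply traj_subset_of_le φ E (Nat.succ_le_of_lt h)
  exact ⟨1, one_mem_traj φ E i, _, ⟨x, hx, rfl⟩, one_mul _⟩

/-- Local move inside a window of length `k` starting at a position `< n`. -/
def Move (φ : G →* G) (F : Subgroup G) (k n : ℕ) (f g : ℕ → G) : Prop :=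
  (∀ j, f j ∈ F) ∧ (∀ j, g j ∈ F) ∧ ∃ i < n, (∀ j, (j < i ∨ i + k ≤ j) → f j = g j) ∧
    pr φ (fun j => f (i + j)) k = pr φ (fun j => g (i + j)) k

/-- All coincidences among products are generated by local moves. -/
def Rel (φ : G →* G) (F : Subgroup G) (k : ℕ) : Prop :=
  ∀ (n : ℕ) (f g : ℕ → G), (∀ j, f j ∈ F) → (∀ j, g j ∈ F) → (∀ j, n ≤ j → f j = g j) →
    pr φ f n = pr φ g n → Relation.ReflTransGen (Move φ F k n) f g

lemma Move.mono {φ : G →* G} {F : Subgroup G} {k k' n : ℕ} (hk : k ≤ k') {f g : ℕ → G}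
    (h : Move φ F k n f g) : Move φ F k' n f g := by
  obtain ⟨hf, hg, i, hi, h1, h2⟩ := h
  refine ⟨hf, hg, i, hi, fun j hj => h1 j (by omega), ?_⟩
  obtain ⟨l, rfl⟩ := Nat.exists_eq_add_of_le hk
  rw [pr_add, pr_add, h2]
  congr 2
  exact pr_congr φ (fun j _ => h1 _ (by omega))

lemma Rel.mono {φ : G →* G} {F : Subgroup G} {k k' : ℕ} (hk : k ≤ k')
    (h : Rel φ F k) : Rel φ F k' := fun n f g hf hg h1 h2 =>
  Relation.ReflTransGen.mono (r := Move φ F k n) (fun _ _ hm => Move.mono hk hm) _ _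
    (h n f g hf hg h1 h2)

lemma Move.pr_eq {φ : G →* G} {F : Subgroup G} {k n m : ℕ} {f g : ℕ → G}
    (h : Move φ F k n f g) (hm : n + k ≤ m) : pr φ f m = pr φ g m := by
  obtain ⟨hf, hg, i, hi, h1, h2⟩ := h
  obtain ⟨l, rfl⟩ := Nat.exists_eq_add_of_le (show i + k ≤ m by omega)
  rw [pr_add φ f (i + k), pr_add φ g (i + k), pr_add φ f i, pr_add φ g i, h2]
  congr 1
  · congr 1
    exact pr_congr φ (fun j hj => h1 j (Or.inl hj))
  · congr 1
    exact pr_congr φ (fun j _ => h1 _ (by omega))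

lemma path_pr_eq {φ : G →* G} {F : Subgroup G} {k n m : ℕ} {f g : ℕ → G}
    (h : Relation.ReflTransGen (Move φ F k n) f g) (hm : n + k ≤ m) : pr φ f m = pr φ g m := by
  induction h with
  | refl => rfl
  | tail _ h2 ih => exact ih.trans (h2.pr_eq hm)

/-- Prepend an element to a sequence. -/
def cns (c : G) (f : ℕ → G) : ℕ → G
  | 0 => c
  | n + 1 => f n

lemma Move.cns {φ : G →* G} {F : Subgroup G} {k n : ℕ} {c : G} (hc : c ∈ F) {f g : ℕ → G}
    (h : Move φ F k n f g) : Move φ F k (n + 1) (cns c f) (cns c g) := by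
  obtain ⟨hf, hg, i, hi, h1, h2⟩ := h
  refine ⟨?_, ?_, i + 1, by omega, ?_, ?_⟩
  · rintro (_ | j); exacts [hc, hf j]
  · rintro (_ | j); exacts [hc, hg j]
  · rintro (_ | j) hj
    · rfl
    · exact h1 j (by omega)
  · simpa only [show ∀ j, i + 1 + j = (i + j) + 1 from fun j => by omega, ATproof.cns] using h2

lemma rel_central {φ : G →* G} (hinj : Function.Injective φ) {C E : Subgroup G}
    (hC : C ≤ Subgroup.center G)
    (hφ : ∀ x ∈ C, φ x ∈ C) (hE : E ≤ C) (hfin : (E : Set G).Finite) : ∃ k, Rel φ E k := by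
  -- stabilisation
  have hstab : ∃ k, ∀ n, ∀ x ∈ E, x ∈ φ '' entTraj φ (E : Set G) n →
      x ∈ φ '' entTraj φ (E : Set G) k := by
    have h1 : ∀ x : G, ∃ k, ∀ n, x ∈ φ '' entTraj φ (E : Set G) n →
        x ∈ φ '' entTraj φ (E : Set G) k := by
      intro x
      by_cases h : ∃ n, x ∈ φ '' entTraj φ (E : Set G) n
      · obtain ⟨n, hn⟩ := h
        exact ⟨n, fun _ _ => hn⟩
      · exact ⟨0, fun n hn => (h ⟨n, hn⟩).elim⟩
    choose κ hκ using h1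
    obtain ⟨K, hK⟩ := (hfin.image κ).bddAbove
    refine ⟨K, fun n x hx hxn => ?_⟩
    exact Set.image_mono (traj_subset_of_le φ E (hK ⟨x, hx, rfl⟩)) (hκ x n hxn)
  obtain ⟨k, hk⟩ := hstab
  refine ⟨k + 1, fun n => ?_⟩
  induction n with
  | zero =>
    intro f g _ _ h _
    rw [show f = g from funext fun j => h j (Nat.zero_le _)]
  | succ n ih =>
    intro f g hf hg h1 h2
    by_cases hn : n + 1 ≤ k + 1
    · apply Relation.ReflTransGen.single
      refine ⟨hf, hg, 0, by omega, fun j hj => h1 j (by omega), ?_⟩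
      simp only [Nat.zero_add]
      exact pr_ext φ hn h2 h1
    · have h3 := h2
      rw [pr_succ', pr_succ'] at h3
      have hx : f 0 * (g 0)⁻¹ ∈ φ '' entTraj φ (E : Set G) n := by
        refine ⟨pr φ (fun j => g (j + 1)) n * (pr φ (fun j => f (j + 1)) n)⁻¹,
          traj_mul_mem hC hφ hE (mem_traj.2 ⟨_, fun j => hg _, rfl⟩)
            (traj_inv_mem hC hφ hE (mem_traj.2 ⟨_, fun j => hf _, rfl⟩)), ?_⟩
        rw [map_mul, map_inv]
        have hc := comm_of_mem hC (hE (hg 0)) (φ (pr φ (fun j => f (j + 1)) n))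
        rw [mul_inv_eq_iff_eq_mul, mul_assoc, ← mul_right_inj (g 0), ← h3]
        have hc' := comm_of_mem hC (hE (hg 0)) (f 0)
        rw [← mul_assoc (g 0), ← hc']
        group
      obtain ⟨y, hy, hyx⟩ := hk n _ (E.mul_mem (hf 0) (E.inv_mem (hg 0))) hx
      obtain ⟨d, hd, rfl⟩ := mem_traj.1 hy
      let t : ℕ → G := fun j => if j < k then d j else 1
      have ht : ∀ j, t j ∈ E := fun j => by
        dsimp only [t]; split_ifs
        exacts [hd j, E.one_mem]
      have htd : pr φ t k = pr φ d k := pr_congr φ (fun j hj => by simp [t, hj])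
      let f' : ℕ → G := cns (g 0) (fun j => f (j + 1) * t j)
      have hf' : ∀ j, f' j ∈ E := by
        rintro (_ | j)
        exacts [hg 0, E.mul_mem (hf _) (ht j)]
      have hff' : ∀ j, k + 1 ≤ j → f j = f' j := by
        rintro (_ | j) hj
        · omega
        · simp [f', cns, t, show ¬ j < k by omega]
      have hkk : pr φ f (k + 1) = pr φ f' (k + 1) := by
        rw [pr_succ', pr_succ']
        have : pr φ (fun j => f' (j + 1)) k = pr φ (fun j => f (j + 1)) k * pr φ d k := by
          rw [← htd]
          exact pr_mul hC hφ _ (fun j => hE (ht j)) k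
        rw [this, map_mul, hyx]
        simp only [f', cns]
        rw [← comm_of_mem hC (hE (E.mul_mem (hf 0) (E.inv_mem (hg 0))))
          (φ (pr φ (fun j => f (j + 1)) k)) |>.symm, ← mul_assoc,
          comm_of_mem hC (hE (hf 0)) (φ (pr φ (fun j => f (j + 1)) k)) |>.symm]
        have hc' := comm_of_mem hC (hE (hg 0))
        rw [← hc' ]
        simp only [mul_assoc]
        simp [comm_of_mem hC (hE (hf 0))]
      have hmove : Move φ E (k + 1) (n + 1) f f' := by
        refine ⟨hf, hf', 0, by omega, fun j hj => hff' j (by omega), ?_⟩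
        simpa only [Nat.zero_add] using hkk
      have hpr : pr φ f' (n + 1) = pr φ f (n + 1) :=
        pr_ext φ (by omega) hkk.symm (fun j hj => (hff' j hj).symm)
      have h7 : pr φ (fun j => f' (j + 1)) n = pr φ (fun j => g (j + 1)) n := by
        have := hpr.trans h2
        rw [pr_succ', pr_succ'] at this
        exact hinj (mul_left_cancel this)
      have hpath := ih (fun j => f' (j + 1)) (fun j => g (j + 1)) (fun j => hf' _)
        (fun j => hg _) (fun j hj => by rw [← hff' _ (by omega)]; exact h1 _ (by omega)) h7
      refine Relation.ReflTransGen.head hmove ?_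
      have e1 : f' = cns (g 0) (fun j => f' (j + 1)) := by
        funext j; cases j <;> rfl
      have e2 : g = cns (g 0) (fun j => g (j + 1)) := by
        funext j; cases j <;> rfl
      rw [e1, e2]
      exact Relation.ReflTransGen.lift (r := Move φ E (k + 1) n) (cns (g 0))
        (fun a b h => Move.cns (hg 0) h) _ _ hpath

end central

section ext

variable {G : Type u} [Group G] {Q : Type v} [Group Q]

lemma ker_inv {φ : G →* G} {ψ : Q →* Q} {p : G →* Q} (h : ∀ x, p (φ x) = ψ (p x)) :
    ∀ x ∈ p.ker, φ x ∈ p.ker := by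
  intro x hx
  rw [MonoidHom.mem_ker] at *
  rw [h, hx, map_one]

lemma step {φ : G →* G} {ψ : Q →* Q} {p : G →* Q} (h : ∀ x, p (φ x) = ψ (p x))
    (hc : p.ker ≤ Subgroup.center G) {F E F' : Subgroup G} {k n : ℕ} (hk : 1 ≤ k)
    (hE : E = p.ker ⊓ Subgroup.closure (entTraj φ (F : Set G) k ∪ (F : Set G)))
    (hFF' : F ≤ F') (hEF' : E ≤ F') {s : Q → G}
    (hs : ∀ q ∈ F.map p, s q ∈ F ∧ p (s q) = q) {a b : ℕ → Q} (hm : Move ψ (F.map p) k n a b)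
    {e : ℕ → G} (he : ∀ j, e j ∈ E) :
    ∃ e' : ℕ → G, (∀ j, e' j ∈ E) ∧ (∀ j, n ≤ j → e' j = e j) ∧
      Move φ F' k n (fun j => s (a j) * e j) (fun j => s (b j) * e' j) := by
  obtain ⟨ha, hb, i, hi, h1, h2⟩ := hm
  have hEk : E ≤ p.ker := hE ▸ inf_le_left
  have hinv := ker_inv h
  set X := pr φ (fun j => s (a (i + j))) k with hX
  set Y := pr φ (fun j => s (b (i + j))) k with hY
  have hXm : X ∈ entTraj φ (F : Set G) k := mem_traj.2 ⟨_, fun j => (hs _ (ha _)).1, rfl⟩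
  have hYm : Y ∈ entTraj φ (F : Set G) k := mem_traj.2 ⟨_, fun j => (hs _ (hb _)).1, rfl⟩
  have hd : Y⁻¹ * X ∈ E := by
    rw [hE]
    refine ⟨?_, ?_⟩
    · change Y⁻¹ * X ∈ p.ker
      rw [MonoidHom.mem_ker, map_mul, map_inv, hX, hY, pr_map h, pr_map h]
      simp only [fun j => (hs _ (ha j)).2, fun j => (hs _ (hb j)).2]
      rw [h2, inv_mul_cancel]
    · exact Subgroup.mul_mem _ (Subgroup.inv_mem _ (Subgroup.subset_closure (Or.inl hYm)))
        (Subgroup.subset_closure (Or.inl hXm))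
  refine ⟨fun j => e j * (if j = i then Y⁻¹ * X else 1), ?_, ?_, ?_, ?_, i, hi, ?_, ?_⟩
  · intro j
    refine E.mul_mem (he j) ?_
    split_ifs
    exacts [hd, E.one_mem]
  · intro j hj
    simp [show j ≠ i by omega]
  · exact fun j => F'.mul_mem (hFF' (hs _ (ha j)).1) (hEF' (he j))
  · intro j
    refine F'.mul_mem (hFF' (hs _ (hb j)).1) (hEF' (E.mul_mem (he j) ?_))
    split_ifs
    exacts [hd, E.one_mem]
  · intro j hj
    simp only [h1 j hj]
    simp [show j ≠ i by omega]
  · have hek : ∀ j, e (i + j) ∈ p.ker := fun j => hEk (he _)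
    have htk : ∀ j : ℕ, (if i + j = i then Y⁻¹ * X else 1) ∈ p.ker := by
      intro j
      split_ifs
      exacts [hEk hd, Subgroup.one_mem _]
    rw [pr_mul hc hinv (fun j => s (a (i + j))) hek,
      pr_mul hc hinv (fun j => s (b (i + j))) (fun j => Subgroup.mul_mem _ (hek j) (htk j)),
      pr_mul hc hinv (fun j => e (i + j)) htk]
    have : pr φ (fun j => if i + j = i then Y⁻¹ * X else 1) k = Y⁻¹ * X := by
      obtain ⟨l, rfl⟩ := Nat.exists_eq_add_of_le' hk
      rw [pr_succ']
      simp [pr_one]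
    rw [this, ← hX, ← hY, comm_of_mem hc (hEk hd), ← mul_assoc, mul_inv_cancel_left]

lemma path {φ : G →* G} {ψ : Q →* Q} {p : G →* Q} (h : ∀ x, p (φ x) = ψ (p x))
    (hc : p.ker ≤ Subgroup.center G) {F E F' : Subgroup G} {k n : ℕ} (hk : 1 ≤ k)
    (hE : E = p.ker ⊓ Subgroup.closure (entTraj φ (F : Set G) k ∪ (F : Set G)))
    (hFF' : F ≤ F') (hEF' : E ≤ F') {s : Q → G}
    (hs : ∀ q ∈ F.map p, s q ∈ F ∧ p (s q) = q) {a b : ℕ → Q}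
    (hm : Relation.ReflTransGen (Move ψ (F.map p) k n) a b)
    {e : ℕ → G} (he : ∀ j, e j ∈ E) :
    ∃ e' : ℕ → G, (∀ j, e' j ∈ E) ∧ (∀ j, n ≤ j → e' j = e j) ∧
      Relation.ReflTransGen (Move φ F' k n) (fun j => s (a j) * e j)
        (fun j => s (b j) * e' j) := by
  induction hm with
  | refl => exact ⟨e, he, fun _ _ => rfl, Relation.ReflTransGen.refl⟩
  | tail _ h2 ih =>
    obtain ⟨e1, he1, h11, hp1⟩ := ih
    obtain ⟨e2, he2, h22, hp2⟩ := step h hc hk hE hFF' hEF' hs h2 he1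
    exact ⟨e2, he2, fun j hj => (h22 j hj).trans (h11 j hj), hp1.tail hp2⟩

theorem ext_key (hLF : IsLocallyFinite G) {φ : G →* G} (hinj : Function.Injective φ)
    {ψ : Q →* Q} {p : G →* Q} (h : ∀ x, p (φ x) = ψ (p x))
    (hc : p.ker ≤ Subgroup.center G) {F : Subgroup G} (hF : (F : Set G).Finite) {k : ℕ}
    (hR : Rel ψ (F.map p) k) :
    ∃ F' E : Subgroup G, F ≤ F' ∧ (F' : Set G).Finite ∧ F'.map p = F.map p ∧ E ≤ p.ker ∧
      (E : Set G).Finite ∧ (∃ k', Rel φ F' k') ∧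
      ∀ n x y, x ∈ entTraj φ (F' : Set G) n → y ∈ entTraj φ (F' : Set G) n → p x = p y →
        y⁻¹ * x ∈ entTraj φ (E : Set G) n := by
  replace hR : Rel ψ (F.map p) (k + 1) := hR.mono (Nat.le_succ k)
  have hk : 1 ≤ k + 1 := by omega
  generalize k + 1 = k at hR hk
  obtain ⟨E, hE⟩ : ∃ E, E = p.ker ⊓ Subgroup.closure (entTraj φ (F : Set G) k ∪ (F : Set G)) :=
    ⟨_, rfl⟩
  have hEk : E ≤ p.ker := hE ▸ inf_le_left
  have hEfin : (E : Set G).Finite := by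
    refine (hLF _ ((traj_finite (φ := φ) hF k).union hF)).subset ?_
    rw [hE]
    exact fun x hx => hx.2
  have hFE : ∀ x ∈ F, p x = 1 → x ∈ E := by
    intro x hx hpx
    rw [hE]
    exact ⟨hpx, Subgroup.subset_closure (Or.inr hx)⟩
  have hEn : E.Normal := normal_of_le_center (hEk.trans hc)
  have hinv := ker_inv h
  have hF'c : ((F ⊔ E : Subgroup G) : Set G) = F * E := Subgroup.mul_normal F E
  have hF'm : (F ⊔ E).map p = F.map p := by
    rw [Subgroup.map_sup, (Subgroup.map_eq_bot_iff E).2 hEk, sup_bot_eq]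
  have hs' : ∀ q : Q, ∃ x, q ∈ F.map p → x ∈ F ∧ p x = q := by
    intro q
    by_cases hq : q ∈ F.map p
    · obtain ⟨x, hx, rfl⟩ := hq
      exact ⟨x, fun _ => ⟨hx, rfl⟩⟩
    · exact ⟨1, fun hq' => (hq hq').elim⟩
  choose s hs using hs'
  have hdec : ∀ x ∈ F ⊔ E, (s (p x))⁻¹ * x ∈ E := by
    intro x hx
    have hx' : x ∈ ((F ⊔ E : Subgroup G) : Set G) := hx
    rw [hF'c] at hx'
    obtain ⟨f, hf, e, he, rfl⟩ := hx'
    have hpe : p e = 1 := hEk he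
    have hh := hs (p f) (Subgroup.mem_map_of_mem p hf)
    change (s (p (f * e)))⁻¹ * (f * e) ∈ E
    rw [map_mul, hpe, mul_one, ← mul_assoc]
    refine E.mul_mem (hFE _ (F.mul_mem (F.inv_mem hh.1) hf) ?_) he
    rw [map_mul, map_inv, hh.2, inv_mul_cancel]
  have key : ∀ (n : ℕ) (f g : ℕ → G), (∀ j, f j ∈ F ⊔ E) → (∀ j, g j ∈ F ⊔ E) →
      (∀ j, n ≤ j → f j = g j) → p (pr φ f n) = p (pr φ g n) →
      ∃ u : ℕ → G, (∀ j, u j ∈ E) ∧ (∀ j, n ≤ j → u j = 1) ∧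
        Relation.ReflTransGen (Move φ (F ⊔ E) k n) f (fun j => g j * u j) := by
    intro n f g hf hg hfg hpr
    rw [pr_map h, pr_map h] at hpr
    have hpath := hR n (fun j => p (f j)) (fun j => p (g j))
      (fun j => hF'm ▸ Subgroup.mem_map_of_mem p (hf j))
      (fun j => hF'm ▸ Subgroup.mem_map_of_mem p (hg j)) (fun j hj => by simp only [hfg j hj]) hpr
    obtain ⟨e', he', h1, h2⟩ := path h hc hk hE (le_sup_left : F ≤ F ⊔ E) le_sup_right hs hpath
      (e := fun j => (s (p (f j)))⁻¹ * f j) (fun j => hdec _ (hf j))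
    refine ⟨fun j => ((s (p (g j)))⁻¹ * g j)⁻¹ * e' j, fun j =>
      E.mul_mem (E.inv_mem (hdec _ (hg j))) (he' j), ?_, ?_⟩
    · intro j hj
      simp only [h1 j hj, hfg j hj]
      group
    · convert h2 using 2 with j j
      · group
      · group
  have key2 : ∀ (n : ℕ) (f g u : ℕ → G), (∀ j, u j ∈ E) → (∀ j, n ≤ j → u j = 1) →
      (∀ j, n ≤ j → f j = g j) →
      Relation.ReflTransGen (Move φ (F ⊔ E) k n) f (fun j => g j * u j) →
      pr φ f n = pr φ g n * pr φ u n := by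
    intro n f g u hu hu1 hfg hpath
    have h1 := path_pr_eq hpath le_rfl
    rw [← pr_mul hc hinv g (fun j => hEk (hu j))]
    exact pr_ext_cancel φ (Nat.le_add_right n k) h1 (fun j hj => by simp [hu1 j hj, hfg j hj])
  refine ⟨F ⊔ E, E, le_sup_left, ?_, hF'm, hEk, hEfin, ?_, ?_⟩
  · rw [hF'c]; exact hF.mul hEfin
  · obtain ⟨k', hk'⟩ := rel_central hinj hc hinv hEk hEfin
    refine ⟨max k k', fun n f g hf hg hfg hpr => ?_⟩
    obtain ⟨u, hu, hu1, hpath⟩ := key n f g hf hg hfg (by rw [hpr])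
    have hu0 : pr φ u n = 1 := by
      have := key2 n f g u hu hu1 hfg hpath
      rw [hpr] at this
      exact (mul_eq_left.1 this.symm)
    have hpu := hk' n u (fun _ => 1) hu (fun _ => E.one_mem) hu1 (by rw [hu0, pr_one])
    have hlift : Relation.ReflTransGen (Move φ (F ⊔ E) k' n) (fun j => g j * u j)
        (fun j => g j * 1) := by
      refine Relation.ReflTransGen.lift (r := Move φ E k' n)
        (fun (u : ℕ → G) => fun j => g j * u j) ?_ _ _ hpu
      rintro a b ⟨ha, hb, i, hi, h1, h2⟩
      refine ⟨fun j => Subgroup.mul_mem _ (hg j) (Subgroup.mem_sup_right (ha j)),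
        fun j => Subgroup.mul_mem _ (hg j) (Subgroup.mem_sup_right (hb j)), i, hi,
        fun j hj => by simp only [h1 j hj], ?_⟩
      rw [pr_mul hc hinv (fun j => g (i + j)) (fun j => hEk (ha (i + j))),
        pr_mul hc hinv (fun j => g (i + j)) (fun j => hEk (hb (i + j))), h2]
    simp only [mul_one] at hlift
    exact (Relation.ReflTransGen.mono (r := Move φ (F ⊔ E) k n)
        (fun _ _ hm => Move.mono (le_max_left k k') hm) _ _ hpath).trans
      (Relation.ReflTransGen.mono (r := Move φ (F ⊔ E) k' n)
        (fun _ _ hm => Move.mono (le_max_right k k') hm) _ _ hlift)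
  · intro n x y hx hy hxy
    obtain ⟨f, hf, rfl⟩ := mem_traj.1 hx
    obtain ⟨g, hg, rfl⟩ := mem_traj.1 hy
    have e1 : pr φ (fun j => if j < n then f j else 1) n = pr φ f n :=
      pr_congr φ (fun j hj => by simp [hj])
    have e2 : pr φ (fun j => if j < n then g j else 1) n = pr φ g n :=
      pr_congr φ (fun j hj => by simp [hj])
    have hfg : ∀ j, n ≤ j → (fun j => if j < n then f j else 1) j =
        (fun j => if j < n then g j else 1) j := by
      intro j hj
      simp [Nat.not_lt.2 hj]
    obtain ⟨u, hu, hu1, hpath⟩ := key n (fun j => if j < n then f j else 1)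
      (fun j => if j < n then g j else 1)
      (fun j => by split_ifs; exacts [hf j, Subgroup.one_mem _])
      (fun j => by split_ifs; exacts [hg j, Subgroup.one_mem _]) hfg
      (by rw [e1, e2, hxy])
    have := key2 n _ _ u hu hu1 hfg hpath
    rw [e1, e2] at this
    rw [this, inv_mul_cancel_left]
    exact mem_traj.2 ⟨u, hu, rfl⟩

/-- Finite subgroups satisfying the local-relation property are cofinal. -/
def CR (φ : G →* G) : Prop :=
  ∀ F : Subgroup G, (F : Set G).Finite → ∃ F' : Subgroup G, F ≤ F' ∧ (F' : Set G).Finite ∧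
    ∃ k, Rel φ F' k

lemma exists_lift (hLF : IsLocallyFinite G) {p : G →* Q} (hp : Function.Surjective p)
    {F₁ : Subgroup G} (hF₁ : (F₁ : Set G).Finite) {F₂ : Subgroup Q} (hF₂ : (F₂ : Set Q).Finite)
    (h12 : F₁.map p ≤ F₂) :
    ∃ F : Subgroup G, F₁ ≤ F ∧ (F : Set G).Finite ∧ F.map p = F₂ := by
  choose s hs using hp
  refine ⟨Subgroup.closure ((F₁ : Set G) ∪ s '' (F₂ : Set Q)), ?_, ?_, ?_⟩
  · exact fun x hx => Subgroup.subset_closure (Or.inl hx)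
  · exact hLF _ (hF₁.union (hF₂.image s))
  · apply le_antisymm
    · rw [Subgroup.map_le_iff_le_comap, Subgroup.closure_le]
      rintro x (hx | ⟨q, hq, rfl⟩)
      · exact h12 (Subgroup.mem_map_of_mem p hx)
      · change p (s q) ∈ F₂
        rw [hs]; exact hq
    · intro q hq
      exact ⟨s q, Subgroup.subset_closure (Or.inr ⟨q, hq, rfl⟩), hs q⟩

theorem CR_ext (hLF : IsLocallyFinite G) {φ : G →* G} (hinj : Function.Injective φ)
    {ψ : Q →* Q} {p : G →* Q} (hp : Function.Surjective p) (h : ∀ x, p (φ x) = ψ (p x))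
    (hc : p.ker ≤ Subgroup.center G) (hψ : CR ψ) : CR φ := by
  intro F₀ hF₀
  obtain ⟨F₂, h1, hF₂, k, hR⟩ := hψ (F₀.map p) (map_finite p hF₀)
  obtain ⟨F, hF0, hF, rfl⟩ := exists_lift hLF hp hF₀ hF₂ h1
  obtain ⟨F', E, h3, h4, _, _, _, h5, _⟩ := ext_key hLF hinj h hc hF hR
  exact ⟨F', hF0.trans h3, h4, h5⟩

end ext

section atc

lemma log_div_tendsto_le {G : Type u} [Group G] {A : Type v} [Group A] {Q : Type w} [Group Q]
    {φ : G →* G} {α : A →* A} {ψ : Q →* Q} {F : Subgroup G} {E : Subgroup A} {F₂ : Subgroup Q}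
    (hF : (F : Set G).Finite) (hE : (E : Set A).Finite) (hF₂ : (F₂ : Set Q).Finite)
    (h : ∀ n, (entTraj φ (F : Set G) n).ncard ≤
      (entTraj ψ (F₂ : Set Q) n).ncard * (entTraj α (E : Set A) n).ncard) :
    entH φ F ≤ entH α E + entH ψ F₂ := by
  refine le_of_tendsto_of_tendsto' (entH_tendsto hF) ((entH_tendsto hE).add (entH_tendsto hF₂))
    (fun n => ?_)
  have h1 := traj_ncard_pos (φ := φ) hF n
  have h2 := traj_ncard_pos (φ := α) hE n
  have h3 := traj_ncard_pos (φ := ψ) hF₂ n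
  rw [← add_div, add_comm, ← Real.log_mul (by positivity) (by positivity)]
  gcongr
  exact_mod_cast h n

lemma log_div_tendsto_ge {G : Type u} [Group G] {A : Type v} [Group A] {Q : Type w} [Group Q]
    {φ : G →* G} {α : A →* A} {ψ : Q →* Q} {F : Subgroup G} {E : Subgroup A} {F₂ : Subgroup Q}
    (hF : (F : Set G).Finite) (hE : (E : Set A).Finite) (hF₂ : (F₂ : Set Q).Finite)
    (h : ∀ n, (entTraj ψ (F₂ : Set Q) n).ncard * (entTraj α (E : Set A) n).ncard ≤
      (entTraj φ (F : Set G) n).ncard) :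
    entH α E + entH ψ F₂ ≤ entH φ F := by
  refine le_of_tendsto_of_tendsto' ((entH_tendsto hE).add (entH_tendsto hF₂)) (entH_tendsto hF)
    (fun n => ?_)
  have h1 := traj_ncard_pos (φ := φ) hF n
  have h2 := traj_ncard_pos (φ := α) hE n
  have h3 := traj_ncard_pos (φ := ψ) hF₂ n
  rw [← add_div, add_comm, ← Real.log_mul (by positivity) (by positivity)]
  gcongr
  exact_mod_cast h n

lemma algEnt_add_le {A : Type v} [Group A] {Q : Type w} [Group Q] {α : A →* A} {ψ : Q →* Q}
    {c : ℝ≥0∞} (h : ∀ (E : Subgroup A) (F₂ : Subgroup Q), (E : Set A).Finite →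
      (F₂ : Set Q).Finite → ENNReal.ofReal (entH α E) + ENNReal.ofReal (entH ψ F₂) ≤ c) :
    algEnt α + algEnt ψ ≤ c := by
  have e1 : algEnt α = ⨆ E : {E : Subgroup A // (E : Set A).Finite},
      ENNReal.ofReal (entH α E.1) := by
    unfold algEnt; rw [iSup_subtype]
  have e2 : algEnt ψ = ⨆ E : {E : Subgroup Q // (E : Set Q).Finite},
      ENNReal.ofReal (entH ψ E.1) := by
    unfold algEnt; rw [iSup_subtype]
  have : Nonempty {E : Subgroup A // (E : Set A).Finite} := ⟨⊥, by simp⟩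
  have : Nonempty {E : Subgroup Q // (E : Set Q).Finite} := ⟨⊥, by simp⟩
  rw [e1, e2]
  exact ENNReal.iSup_add_iSup_le fun E F => h E.1 F.1 E.2 F.2

theorem AT_central {A : Type u} [Group A] {G : Type v} [Group G] {Q : Type w} [Group Q]
    (hLF : IsLocallyFinite G) {α : A →* A} {φ : G →* G} {ψ : Q →* Q} {ι : A →* G} {p : G →* Q}
    (hinj : Function.Injective φ) (hι : Function.Injective ι) (hp : Function.Surjective p)
    (hex : ι.range = p.ker) (hαι : ∀ x, ι (α x) = φ (ι x)) (h : ∀ x, p (φ x) = ψ (p x))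
    (hc : p.ker ≤ Subgroup.center G) (hψ : CR ψ) : algEnt φ = algEnt α + algEnt ψ := by
  apply le_antisymm
  · refine iSup₂_le fun F₀ hF₀ => ?_
    obtain ⟨F₂, h1, hF₂, k, hR⟩ := hψ (F₀.map p) (map_finite p hF₀)
    obtain ⟨F, hF0, hF, rfl⟩ := exists_lift hLF hp hF₀ hF₂ h1
    obtain ⟨F', E, h3, h4, h5, h6, h7, _, h8⟩ := ext_key hLF hinj h hc hF hR
    have hEm : (E.comap ι).map ι = E := by
      rw [Subgroup.map_comap_eq, hex]
      exact inf_eq_right.2 h6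
    have hEfin : ((E.comap ι : Subgroup A) : Set A).Finite := by
      rw [Subgroup.coe_comap]
      exact h7.preimage hι.injOn
    have hle : entH φ F' ≤ entH α (E.comap ι) + entH ψ (F'.map p) := by
      refine log_div_tendsto_le h4 hEfin (map_finite p h4) (fun n => ?_)
      have e1 : (entTraj α ((E.comap ι : Subgroup A) : Set A) n).ncard =
          (entTraj φ (E : Set G) n).ncard := by
        conv_rhs => rw [← hEm]
        rw [traj_map hαι, Set.ncard_image_of_injective _ hι]
      rw [e1, ← Set.ncard_prod, traj_map h]
      have hr : ∀ q : Q, ∃ y : G, q ∈ p '' entTraj φ (F' : Set G) n →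
          y ∈ entTraj φ (F' : Set G) n ∧ p y = q := by
        intro q
        by_cases hq : q ∈ p '' entTraj φ (F' : Set G) n
        · obtain ⟨y, hy, rfl⟩ := hq
          exact ⟨y, fun _ => ⟨hy, rfl⟩⟩
        · exact ⟨1, fun hh => (hq hh).elim⟩
      choose r hr using hr
      refine Set.ncard_le_ncard_of_injOn (fun x => (p x, (r (p x))⁻¹ * x)) ?_ ?_ ?_
      · intro x hx
        have := hr (p x) ⟨x, hx, rfl⟩
        exact ⟨⟨x, hx, rfl⟩, h8 n x _ hx this.1 this.2.symm⟩
      · intro x _ y _ hxy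
        simp only [Prod.mk.injEq] at hxy
        rw [hxy.1] at hxy
        exact mul_left_cancel hxy.2
      · exact ((traj_finite h4 n).image p).prod (traj_finite h7 n)
    calc ENNReal.ofReal (entH φ F₀) ≤ ENNReal.ofReal (entH φ F') :=
          ENNReal.ofReal_le_ofReal (entH_mono h4 (hF0.trans h3))
      _ ≤ ENNReal.ofReal (entH α (E.comap ι) + entH ψ (F'.map p)) := ENNReal.ofReal_le_ofReal hle
      _ = ENNReal.ofReal (entH α (E.comap ι)) + ENNReal.ofReal (entH ψ (F'.map p)) :=
          ENNReal.ofReal_add (entH_nonneg hEfin) (entH_nonneg (map_finite p h4))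
      _ ≤ _ := add_le_add (entH_le_algEnt hEfin) (entH_le_algEnt (map_finite p h4))
  · refine algEnt_add_le fun E F₂ hE hF₂ => ?_
    have hEk : E.map ι ≤ p.ker := by
      rw [← hex, MonoidHom.range_eq_map]
      exact Subgroup.map_mono le_top
    obtain ⟨F, h1, hF, rfl⟩ := exists_lift hLF hp (map_finite ι hE) hF₂
      (by rw [(Subgroup.map_eq_bot_iff _).2 hEk]; exact bot_le)
    rw [← ENNReal.ofReal_add (entH_nonneg hE) (entH_nonneg hF₂)]
    refine le_trans (ENNReal.ofReal_le_ofReal ?_) (entH_le_algEnt hF)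
    refine log_div_tendsto_ge hF hE hF₂ (fun n => ?_)
    rw [traj_map h, ← Set.ncard_prod]
    have hr : ∀ q : Q, ∃ y : G, q ∈ p '' entTraj φ (F : Set G) n →
        y ∈ entTraj φ (F : Set G) n ∧ p y = q := by
      intro q
      by_cases hq : q ∈ p '' entTraj φ (F : Set G) n
      · obtain ⟨y, hy, rfl⟩ := hq
        exact ⟨y, fun _ => ⟨hy, rfl⟩⟩
      · exact ⟨1, fun hh => (hq hh).elim⟩
    choose r hr using hr
    have hpi : ∀ a, p (ι a) = 1 := fun a => by
      have : ι a ∈ p.ker := hex ▸ ⟨a, rfl⟩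
      exact this
    refine Set.ncard_le_ncard_of_injOn (fun x => r x.1 * ι x.2) ?_ ?_ (traj_finite hF n)
    · rintro ⟨q, a⟩ ⟨hq, ha⟩
      obtain ⟨f, hf, hfq⟩ := mem_traj.1 (hr q hq).1
      obtain ⟨g, hg, rfl⟩ := mem_traj.1 ha
      change r q * ι (pr α g n) ∈ _
      rw [← hfq, pr_map hαι, ← pr_mul hc (ker_inv h) f (g := fun j => ι (g j)) (fun j => hpi _)]
      exact mem_traj.2 ⟨_, fun j => F.mul_mem (hf j) (h1 (Subgroup.mem_map_of_mem ι (hg j))), rfl⟩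
    · rintro ⟨q, a⟩ ⟨hq, ha⟩ ⟨q', a'⟩ ⟨hq', ha'⟩ heq
      simp only at heq hq hq'
      have h2 := congrArg p heq
      rw [map_mul, map_mul, hpi, hpi, mul_one, mul_one, (hr q hq).2, (hr q' hq').2] at h2
      subst h2
      rw [hι (mul_left_cancel heq)]

end atc

section nilp

lemma LF_of_surj {G : Type u} [Group G] {Q : Type v} [Group Q] (hLF : IsLocallyFinite G)
    {p : G →* Q} (hp : Function.Surjective p) : IsLocallyFinite Q := by
  intro S hS
  choose s hs using hp
  have := (hLF _ (hS.image s)).image p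
  rw [← Subgroup.coe_map, MonoidHom.map_closure, Set.image_image] at this
  simpa [hs] using this

lemma LF_of_inj {G : Type u} [Group G] {Q : Type v} [Group Q] (hLF : IsLocallyFinite Q)
    {p : G →* Q} (hp : Function.Injective p) : IsLocallyFinite G := by
  intro S hS
  have := hLF _ (hS.image p)
  rw [← MonoidHom.map_closure, Subgroup.coe_map] at this
  exact this.of_finite_image hp.injOn

lemma LF_ext {G : Type u} [Group G] (ht : ∀ x : G, IsOfFinOrder x)
    (h : IsLocallyFinite (G ⧸ Subgroup.center G)) : IsLocallyFinite G := by
  intro S hS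
  have hfin := h _ (hS.image (QuotientGroup.mk' (Subgroup.center G)))
  rw [← MonoidHom.map_closure] at hfin
  set K := Subgroup.closure S with hK
  have hKfg : Group.FG K := by
    rw [Group.fg_iff_subgroup_fg]
    exact ⟨hS.toFinset, by simp [hK]⟩
  set N : Subgroup K := (Subgroup.center G).subgroupOf K with hN
  let q : K →* (G ⧸ Subgroup.center G) := (QuotientGroup.mk' (Subgroup.center G)).comp K.subtype
  have hqk : q.ker = N := by
    ext x
    simp [q, hN, MonoidHom.mem_ker, Subgroup.mem_subgroupOf]
  have hqr : Finite q.range := by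
    have : q.range = K.map (QuotientGroup.mk' (Subgroup.center G)) := by
      simp only [q, MonoidHom.range_comp, Subgroup.range_subtype]
    rw [this]
    exact Set.Finite.to_subtype hfin
  have hfi : N.FiniteIndex := by
    rw [← hqk]
    exact Subgroup.finiteIndex_ker q
  have hNfg : Group.FG N := Subgroup.fg_of_index_ne_zero N
  have hcomm : ∀ a b : N, a * b = b * a := by
    intro a b
    have : (a : K) * b = b * a :=
      Subtype.ext (Subgroup.mem_center_iff.1 (Subgroup.mem_subgroupOf.1 b.2) _)
    exact Subtype.ext this
  have hNt : ∀ x : N, IsOfFinOrder x := fun x => by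
    have h1 := ht ((K.subtype.comp N.subtype) x)
    rwa [Function.Injective.isOfFinOrder_iff
      (Subtype.val_injective.comp Subtype.val_injective)] at h1
  have hNfin : Finite N := by
    letI : CommGroup N := { (inferInstance : Group N) with mul_comm := hcomm }
    exact CommGroup.finite_of_fg_isMulTorsion N hNt
  have hKfin : Finite K := by
    apply Nat.finite_of_card_ne_zero
    rw [← N.card_mul_index]
    exact mul_ne_zero Nat.card_pos.ne' hfi.index_ne_zero
  exact Set.toFinite (K : Set G)

end nilp

section nilp2

lemma LF_nilp (G : Type u) [Group G] [Group.IsNilpotent G] :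
    (∀ x : G, IsOfFinOrder x) → IsLocallyFinite G := by
  refine Group.nilpotent_center_quotient_ind
    (P := fun G _ _ => (∀ x : G, IsOfFinOrder x) → IsLocallyFinite G) G ?_ ?_
  · intro G _ _ _ S _
    exact Set.toFinite _
  · intro G _ _ ih ht
    refine LF_ext ht (ih fun x => ?_)
    obtain ⟨y, rfl⟩ := QuotientGroup.mk_surjective x
    exact (QuotientGroup.mk' (Subgroup.center G)).isOfFinOrder (ht y)

lemma center_mem_iff {G : Type u} [Group G] {φ : G →* G} (hφ : Function.Bijective φ) (x : G) :
    φ x ∈ Subgroup.center G ↔ x ∈ Subgroup.center G := by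
  simp only [Subgroup.mem_center_iff]
  constructor
  · intro h g
    apply hφ.1
    rw [map_mul, map_mul, h]
  · intro h g
    obtain ⟨g, rfl⟩ := hφ.2 g
    rw [← map_mul, ← map_mul, h]

lemma map_bijective {G : Type u} [Group G] {φ : G →* G} (hφ : Function.Bijective φ)
    (N : Subgroup G) [N.Normal] (hN : ∀ x, φ x ∈ N ↔ x ∈ N) (h : N ≤ N.comap φ) :
    Function.Bijective (QuotientGroup.map N N φ h) := by
  constructor
  · rw [injective_iff_map_eq_one]
    intro x hx
    obtain ⟨x, rfl⟩ := QuotientGroup.mk_surjective x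
    rw [QuotientGroup.map_mk, QuotientGroup.eq_one_iff, hN] at hx
    rwa [QuotientGroup.eq_one_iff]
  · intro x
    obtain ⟨x, rfl⟩ := QuotientGroup.mk_surjective x
    obtain ⟨x, rfl⟩ := hφ.2 x
    exact ⟨QuotientGroup.mk x, rfl⟩

lemma CR_nilp (G : Type u) [Group G] [Group.IsNilpotent G] :
    IsLocallyFinite G → ∀ φ : G →* G, Function.Bijective φ → CR φ := by
  refine Group.nilpotent_center_quotient_ind
    (P := fun G _ _ => IsLocallyFinite G → ∀ φ : G →* G, Function.Bijective φ → CR φ) G ?_ ?_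
  · intro G _ _ _ φ _ F hF
    refine ⟨F, le_rfl, hF, 0, fun n f g _ _ _ _ => ?_⟩
    rw [show f = g from funext fun _ => Subsingleton.elim _ _]
  · intro G _ _ ih hLF φ hφ
    have hmem := center_mem_iff hφ
    have hle : Subgroup.center G ≤ (Subgroup.center G).comap φ := fun x hx => (hmem x).2 hx
    have hs := QuotientGroup.mk'_surjective (Subgroup.center G)
    refine CR_ext hLF hφ.1 hs (ψ := QuotientGroup.map _ _ φ hle) (fun x => rfl)
      (QuotientGroup.ker_mk' _).le (ih (LF_of_surj hLF hs) _ (map_bijective hφ _ hmem hle))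

lemma ucs_quot {G : Type u} [Group G] {R N : Subgroup G} [hN : N.Normal] (hR : R.Normal)
    (hRN : ∀ x ∈ R, x ∈ Subgroup.center G → x ∈ N) (d : ℕ) :
    ∀ x ∈ R, x ∈ Subgroup.upperCentralSeries G (d + 1) →
      (QuotientGroup.mk x : G ⧸ N) ∈ Subgroup.upperCentralSeries (G ⧸ N) d := by
  induction d with
  | zero =>
    intro x hx hx1
    rw [Subgroup.upperCentralSeries_zero, Subgroup.mem_bot, QuotientGroup.eq_one_iff]
    refine hRN x hx ?_
    rwa [zero_add, Subgroup.upperCentralSeries_one] at hx1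
  | succ d ih =>
    intro x hx hx1
    rw [Subgroup.mem_upperCentralSeries_succ_iff] at hx1 ⊢
    intro y
    obtain ⟨y, rfl⟩ := QuotientGroup.mk_surjective y
    have := ih (x * y * x⁻¹ * y⁻¹) ?_ (hx1 y)
    · exact this
    · rw [mul_assoc, mul_assoc, ← mul_assoc y]
      exact R.mul_mem hx (hR.conj_mem _ (R.inv_mem hx) y)

theorem AT_nilp (d : ℕ) : ∀ {A G Q : Type u} [Group A] [Group G] [Group Q]
    {α : A →* A} {φ : G →* G} {ψ : Q →* Q} {ι : A →* G} {p : G →* Q},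
    Function.Bijective α → Function.Bijective φ → Function.Bijective ψ →
    Function.Injective ι → Function.Surjective p → ι.range = p.ker →
    (∀ x, ι (α x) = φ (ι x)) → (∀ x, p (φ x) = ψ (p x)) →
    IsLocallyFinite G → Group.IsNilpotent G → ι.range ≤ Subgroup.upperCentralSeries G d →
    algEnt φ = algEnt α + algEnt ψ := by
  induction d with
  | zero =>
    intro A G Q _ _ _ α φ ψ ι p hα hφ hψ hι hp hex h1 h2 hLF hG hd
    have : Group.IsNilpotent Q := Group.nilpotent_of_surjective p hp
    refine AT_central hLF hφ.1 hι hp hex h1 h2 ?_ (CR_nilp Q (LF_of_surj hLF hp) ψ hψ)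
    rw [← hex]
    refine hd.trans ?_
    simp
  | succ d ih =>
    intro A G Q _ _ _ α φ ψ ι p hα hφ hψ hι hp hex h1 h2 hLF hG hd
    have hLFA : IsLocallyFinite A := LF_of_inj hLF hι
    have hA : Group.IsNilpotent A := Subgroup.isNilpotent_of_ker_le_center ι
      (by rw [(MonoidHom.ker_eq_bot_iff ι).2 hι]; exact bot_le)
    have hpι : ∀ a, p (ι a) = 1 := fun a => by
      have : ι a ∈ p.ker := hex ▸ ⟨a, rfl⟩
      exact this
    let A1 : Subgroup A := (Subgroup.center G).comap ι
    let N : Subgroup G := A1.map ι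
    have hNc : N ≤ Subgroup.center G := Subgroup.map_comap_le _ _
    have hA1c : A1 ≤ Subgroup.center A := by
      intro x hx
      rw [Subgroup.mem_center_iff]
      intro g
      apply hι
      rw [map_mul, map_mul]
      exact Subgroup.mem_center_iff.1 hx _
    haveI hNn : N.Normal := normal_of_le_center hNc
    haveI hA1n : A1.Normal := normal_of_le_center hA1c
    have hA1 : ∀ x, α x ∈ A1 ↔ x ∈ A1 := by
      intro x
      simp only [A1, Subgroup.mem_comap, h1]
      exact center_mem_iff hφ _
    have hιN : ∀ a, ι a ∈ N ↔ a ∈ A1 := fun a => Subgroup.mem_map_iff_mem hι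
    have hN : ∀ x, φ x ∈ N ↔ x ∈ N := by
      intro x
      constructor
      · rintro ⟨a, ha, hx⟩
        obtain ⟨b, rfl⟩ := hα.2 a
        rw [h1] at hx
        rw [← hφ.1 hx, hιN]
        exact (hA1 _).1 ha
      · rintro ⟨a, ha, rfl⟩
        rw [← h1, hιN]
        exact (hA1 _).2 ha
    have hA1le : A1 ≤ A1.comap α := fun x hx => (hA1 x).2 hx
    have hNle : N ≤ N.comap φ := fun x hx => (hN x).2 hx
    have hιle : A1 ≤ N.comap ι := fun x hx => (hιN x).2 hx
    have hNp : N ≤ p.ker := by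
      rintro _ ⟨a, _, rfl⟩
      exact hpι a
    let α1 : A1 →* A1 := endRestrict α A1 hA1le
    let αq := QuotientGroup.map A1 A1 α hA1le
    let φq := QuotientGroup.map N N φ hNle
    let ιq := QuotientGroup.map A1 N ι hιle
    let pq : G ⧸ N →* Q := QuotientGroup.lift N p hNp
    have hαq : Function.Bijective αq := map_bijective hα A1 hA1 hA1le
    have hφq : Function.Bijective φq := map_bijective hφ N hN hNle
    have sA := QuotientGroup.mk'_surjective A1
    have sG := QuotientGroup.mk'_surjective N
    have nA : Group.IsNilpotent (A ⧸ A1) := Group.nilpotent_of_surjective _ sA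
    have nG : Group.IsNilpotent (G ⧸ N) := Group.nilpotent_of_surjective _ sG
    have lA : IsLocallyFinite (A ⧸ A1) := LF_of_surj hLFA sA
    have lG : IsLocallyFinite (G ⧸ N) := LF_of_surj hLF sG
    have e1 : algEnt α = algEnt α1 + algEnt αq := by
      refine AT_central hLFA hα.1 (ι := A1.subtype) (p := QuotientGroup.mk' A1)
        Subtype.val_injective sA ?_ (fun x => rfl) (fun x => rfl) ?_ (CR_nilp _ lA _ hαq)
      · rw [Subgroup.range_subtype, QuotientGroup.ker_mk']
      · rw [QuotientGroup.ker_mk']; exact hA1c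
    have e2 : algEnt φ = algEnt α1 + algEnt φq := by
      refine AT_central hLF hφ.1 (ι := ι.comp A1.subtype) (p := QuotientGroup.mk' N)
        (hι.comp Subtype.val_injective) sG ?_ (fun x => h1 _) (fun x => rfl) ?_
        (CR_nilp _ lG _ hφq)
      · rw [MonoidHom.range_comp, Subgroup.range_subtype, QuotientGroup.ker_mk']
      · rw [QuotientGroup.ker_mk']; exact hNc
    have e3 : algEnt φq = algEnt αq + algEnt ψ := by
      refine ih (ι := ιq) (p := pq) hαq hφq hψ ?_ ?_ ?_ ?_ ?_ lG nG ?_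
      · rw [injective_iff_map_eq_one]
        intro x hx
        obtain ⟨x, rfl⟩ := QuotientGroup.mk_surjective x
        rw [QuotientGroup.map_mk, QuotientGroup.eq_one_iff, hιN] at hx
        rwa [QuotientGroup.eq_one_iff]
      · intro y
        obtain ⟨x, rfl⟩ := hp y
        exact ⟨QuotientGroup.mk x, rfl⟩
      · ext x
        obtain ⟨x, rfl⟩ := QuotientGroup.mk_surjective x
        constructor
        · rintro ⟨a, ha⟩
          obtain ⟨a, rfl⟩ := QuotientGroup.mk_surjective a
          rw [← ha]
          exact hpι a
        · intro hx
          have hx' : x ∈ ι.range := by rw [hex]; exact hx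
          obtain ⟨a, rfl⟩ := hx'
          exact ⟨QuotientGroup.mk a, rfl⟩
      · intro x
        obtain ⟨x, rfl⟩ := QuotientGroup.mk_surjective x
        exact congrArg (QuotientGroup.mk (s := N)) (h1 x)
      · intro x
        obtain ⟨x, rfl⟩ := QuotientGroup.mk_surjective x
        exact h2 x
      · rintro _ ⟨a, rfl⟩
        obtain ⟨a, rfl⟩ := QuotientGroup.mk_surjective a
        refine ucs_quot (R := ι.range) (N := N) (hex ▸ inferInstance) ?_ d (ι a) ⟨a, rfl⟩
          (hd ⟨a, rfl⟩)
        rintro _ ⟨b, rfl⟩ hb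
        exact (hιN b).2 hb
    rw [e2, e1, e3, add_assoc]

lemma ucs_sub {G : Type u} [Group G] (K : Subgroup G) (i : ℕ) :
    (Subgroup.upperCentralSeries G i).subgroupOf K ≤ Subgroup.upperCentralSeries K i := by
  induction i with
  | zero =>
    intro x hx
    rw [Subgroup.mem_subgroupOf, Subgroup.upperCentralSeries_zero, Subgroup.mem_bot] at hx
    rw [Subgroup.upperCentralSeries_zero, Subgroup.mem_bot]
    exact Subtype.ext hx
  | succ i ih =>
    intro x hx
    rw [Subgroup.mem_subgroupOf, Subgroup.mem_upperCentralSeries_succ_iff] at hx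
    rw [Subgroup.mem_upperCentralSeries_succ_iff]
    intro y
    exact ih (Subgroup.mem_subgroupOf.2 (hx y))

lemma ucs_self {G : Type u} [Group G] (c : ℕ) :
    Subgroup.upperCentralSeries (Subgroup.upperCentralSeries G c) c = ⊤ := by
  rw [eq_top_iff]
  refine le_trans ?_ (ucs_sub _ c)
  rw [Subgroup.subgroupOf_self]

end nilp2

section final

theorem main {G : Type u} [Group G] (ht : ∀ x : G, IsOfFinOrder x)
    (hhyp : ∀ g : G, ∃ n : ℕ, g ∈ Subgroup.upperCentralSeries G n)
    (φ : G ≃* G) (H : Subgroup G) [hN : H.Normal]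
    (hst : ∀ x : G, φ x ∈ H ↔ x ∈ H) (hH : H ≤ H.comap φ.toMonoidHom) :
    algEnt φ.toMonoidHom = algEnt (endRestrict φ.toMonoidHom H hH) +
      algEnt (QuotientGroup.map H H φ.toMonoidHom hH) := by
  let Z : ℕ → Subgroup G := fun c => Subgroup.upperCentralSeries G c
  have hZle : ∀ c, Z c ≤ (Z c).comap φ.toMonoidHom := fun c => upperCentralSeries_le_comap φ c
  have hZmem : ∀ c x, φ x ∈ Z c ↔ x ∈ Z c := by
    intro c x
    have := comap_upperCentralSeries φ c
    exact (SetLike.ext_iff.1 this x)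
  have hmono : ∀ {a b}, a ≤ b → Z a ≤ Z b := fun h => Subgroup.upperCentralSeries_mono G h
  have hfin : ∀ S : Set G, S.Finite → ∃ c, S ⊆ Z c := by
    intro S hS
    choose n hn using hhyp
    obtain ⟨c, hc⟩ := (hS.image n).bddAbove
    exact ⟨c, fun x hx => hmono (hc ⟨x, hx, rfl⟩) (hn x)⟩
  let r : ∀ c, Z c →* Z c := fun c => endRestrict φ.toMonoidHom (Z c) (hZle c)
  let A : ∀ c, Subgroup (Z c) := fun c => H.subgroupOf (Z c)
  have hrA : ∀ c x, r c x ∈ A c ↔ x ∈ A c := fun c x => hst x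
  have hAle : ∀ c, A c ≤ (A c).comap (r c) := fun c x hx => (hrA c x).2 hx
  let a : ∀ c, A c →* A c := fun c => endRestrict (r c) (A c) (hAle c)
  let q : ∀ c, Z c ⧸ A c →* Z c ⧸ A c := fun c => QuotientGroup.map (A c) (A c) (r c) (hAle c)
  have hr : ∀ c, Function.Bijective (r c) := by
    intro c
    constructor
    · intro x y hxy
      exact Subtype.ext (φ.injective (congrArg Subtype.val hxy))
    · intro y
      obtain ⟨x, hx⟩ := φ.surjective (y : G)
      exact ⟨⟨x, (hZmem c x).1 (hx ▸ y.2)⟩, Subtype.ext hx⟩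
  have ha : ∀ c, Function.Bijective (a c) := by
    intro c
    constructor
    · intro x y hxy
      exact Subtype.ext ((hr c).1 (congrArg Subtype.val hxy))
    · intro y
      obtain ⟨x, hx⟩ := (hr c).2 (y : Z c)
      exact ⟨⟨x, (hrA c x).1 (hx ▸ y.2)⟩, Subtype.ext hx⟩
  have hq : ∀ c, Function.Bijective (q c) := fun c => map_bijective (hr c) (A c) (hrA c) (hAle c)
  have hadd : ∀ c, algEnt (r c) = algEnt (a c) + algEnt (q c) := by
    intro c
    have hnil : Group.IsNilpotent (Z c) := ⟨c, ucs_self c⟩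
    have hLF : IsLocallyFinite (Z c) := LF_nilp _ fun x => by
      have h1 := ht ((Z c).subtype x)
      rwa [Function.Injective.isOfFinOrder_iff Subtype.val_injective] at h1
    refine AT_nilp c (ι := (A c).subtype) (p := QuotientGroup.mk' (A c)) (ha c) (hr c) (hq c)
      Subtype.val_injective (QuotientGroup.mk'_surjective _) ?_ (fun x => rfl) (fun x => rfl)
      hLF hnil ?_
    · rw [Subgroup.range_subtype, QuotientGroup.ker_mk']
    · have := ucs_self (G := G) c
      exact le_top.trans this.ge
  let jA : ∀ c, A c →* H := fun c =>
    ((Z c).subtype.comp (A c).subtype).codRestrict H (fun x => x.2)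
  have hjA : ∀ c, Function.Injective (jA c) := by
    intro c x y hxy
    exact Subtype.ext (Subtype.ext (congrArg (fun z : H => (z : G)) hxy))
  let jQ : ∀ c, Z c ⧸ A c →* G ⧸ H := fun c =>
    QuotientGroup.map (A c) H (Z c).subtype (fun x hx => hx)
  have hjQ : ∀ c, Function.Injective (jQ c) := by
    intro c
    rw [injective_iff_map_eq_one]
    intro x hx
    obtain ⟨x, rfl⟩ := QuotientGroup.mk_surjective x
    have hx : (QuotientGroup.mk (x : G) : G ⧸ H) = 1 := hx
    rw [QuotientGroup.eq_one_iff] at hx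
    rw [QuotientGroup.eq_one_iff]
    exact hx
  have iA : ∀ c x, jA c (a c x) = endRestrict φ.toMonoidHom H hH (jA c x) := fun c x => rfl
  have iQ : ∀ c x, jQ c (q c x) = QuotientGroup.map H H φ.toMonoidHom hH (jQ c x) := by
    intro c x
    obtain ⟨x, rfl⟩ := QuotientGroup.mk_surjective x
    rfl
  have iZ : ∀ c x, (Z c).subtype (r c x) = φ.toMonoidHom ((Z c).subtype x) := fun c x => rfl
  apply le_antisymm
  · refine iSup₂_le fun F hF => ?_
    obtain ⟨c, hc⟩ := hfin F hF
    have hm : (F.subgroupOf (Z c)).map (Z c).subtype = F := by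
      rw [Subgroup.subgroupOf_map_subtype]
      exact inf_eq_left.2 hc
    have hFf : ((F.subgroupOf (Z c) : Subgroup (Z c)) : Set (Z c)).Finite := by
      have := hF.preimage (f := (Subtype.val : Z c → G)) Subtype.val_injective.injOn
      exact this
    rw [← hm, entH_map (iZ c) Subtype.val_injective]
    refine (entH_le_algEnt hFf).trans ?_
    rw [hadd c]
    exact add_le_add (algEnt_mono (iA c) (hjA c)) (algEnt_mono (iQ c) (hjQ c))
  · refine algEnt_add_le fun E F hE hF => ?_
    obtain ⟨c, hc⟩ := hfin (((↑) '' (E : Set H)) ∪ (Quotient.out '' (F : Set (G ⧸ H))))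
      ((hE.image _).union (hF.image _))
    have hEm : (E.comap (jA c)).map (jA c) = E := by
      rw [Subgroup.map_comap_eq]
      refine inf_eq_right.2 fun x hx => ?_
      exact ⟨⟨⟨x, hc (Or.inl ⟨x, hx, rfl⟩)⟩, x.2⟩, rfl⟩
    have hFm : (F.comap (jQ c)).map (jQ c) = F := by
      rw [Subgroup.map_comap_eq]
      refine inf_eq_right.2 fun x hx => ?_
      exact ⟨QuotientGroup.mk ⟨x.out, hc (Or.inr ⟨x, hx, rfl⟩)⟩, QuotientGroup.out_eq' x⟩
    have hEf : ((E.comap (jA c) : Subgroup (A c)) : Set (A c)).Finite := by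
      have := hE.preimage (f := jA c) (hjA c).injOn
      exact this
    have hFf : ((F.comap (jQ c) : Subgroup (Z c ⧸ A c)) : Set (Z c ⧸ A c)).Finite := by
      have := hF.preimage (f := jQ c) (hjQ c).injOn
      exact this
    rw [← hEm, ← hFm, entH_map (iA c) (hjA c), entH_map (iQ c) (hjQ c)]
    refine (add_le_add (entH_le_algEnt hEf) (entH_le_algEnt hFf)).trans ?_
    rw [← hadd c]
    exact algEnt_mono (iZ c) Subtype.val_injective

end final

end ATproof

/-- Let `G` be a torsion `ω`-hypercentral group (that is, a torsion
group with `G = ⋃_n Z_n(G)`) and let `φ` be an automorphism of `G`. Then for every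
`φ`-stable normal subgroup `H` of `G`, `h(φ) = h(φ↾_H) + h(φ̄)`. -/
theorem AT_omega_hypercentral {G : Type*} [Group G] (htor : Monoid.IsTorsion G)
    (hhyp : ∀ g : G, ∃ n : ℕ, g ∈ upperCentralSeries G n)
    (φ : G ≃* G) (H : Subgroup G) (hN : H.Normal)
    (hst : ∀ x : G, φ x ∈ H ↔ x ∈ H) :
    AlgEntropy.AT φ.toMonoidHom H hN
      (fun x hx => Subgroup.mem_comap.mpr ((hst x).mpr hx)) := by
  exact ATproof.main htor hhyp φ H hst _
end

section
/- Let G be a torsion ω-hypercentral group (i.e. every element of G has finite order and G = ⋃_{n∈ℕ} Z_n(G), where Z_n(G) denotes the upper central series) and let φ be an automorphism of G. Then either h(φ) = ∞ or h(φ) = log(α) for some positive integer α. -/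
open scoped Pointwise ENNReal

namespace AlgEntropy

section Helpers

universe u

variable {G : Type*} [Group G]

/-- the intersection of `F` with its preimage -/
def entD (φ : G →* G) (F : Subgroup G) : Subgroup G := F ⊓ F.comap φ

/-- the index `[F : F ∩ φ⁻¹ F]` -/
noncomputable def entI (φ : G →* G) (F : Subgroup G) : ℕ := (entD φ F).relIndex F

lemma card_entD_mul (φ : G →* G) (F : Subgroup G) :
    Nat.card (entD φ F) * entI φ F = Nat.card F := by
  have := Subgroup.relIndex_mul_relIndex ⊥ (entD φ F) F bot_le inf_le_left
  rwa [Subgroup.relIndex_bot_left, Subgroup.relIndex_bot_left] at this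

lemma entI_pos (φ : G →* G) (F : Subgroup G) (hF : (F : Set G).Finite) : 0 < entI φ F := by
  have : Finite F := hF
  have h := card_entD_mul φ F
  have h2 : 0 < Nat.card F := Nat.card_pos
  rw [← h] at h2
  exact Nat.pos_of_mul_pos_left h2

lemma entTraj_finite (φ : G →* G) {F : Set G} (hF : F.Finite) (n : ℕ) :
    (entTraj φ F n).Finite := by
  induction n with
  | zero => exact Set.finite_singleton 1
  | succ n ih => exact ih.mul (hF.image _)

lemma entTraj_mono (φ : G →* G) {F F' : Set G} (h : F ⊆ F') (n : ℕ) :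
    entTraj φ F n ⊆ entTraj φ F' n := by
  induction n with
  | zero => exact subset_rfl
  | succ n ih => exact Set.mul_subset_mul ih (Set.image_mono h)

lemma one_mem_entTraj (φ : G →* G) (F : Subgroup G) (n : ℕ) :
    (1 : G) ∈ entTraj φ (F : Set G) n := by
  induction n with
  | zero => exact Set.mem_singleton 1
  | succ n ih => exact Set.mem_mul.2 ⟨1, ih, 1, ⟨1, F.one_mem, iterate_map_one φ n⟩, one_mul 1⟩

lemma entTraj_ncard_pos (φ : G →* G) (F : Subgroup G) (hF : (F : Set G).Finite) (n : ℕ) :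
    0 < (entTraj φ (F : Set G) n).ncard :=
  (Set.ncard_pos (entTraj_finite φ hF n)).2 ⟨1, one_mem_entTraj φ F n⟩

lemma entTraj_upper (φ : G →* G) (F : Subgroup G) (hF : (F : Set G).Finite) (n : ℕ) :
    (entTraj φ (F : Set G) (n+1)).ncard ≤ Nat.card F * entI φ F ^ n := by
  have : Finite F := hF
  induction n with
  | zero =>
    simp [entTraj]
    rfl
  | succ n ih =>
    obtain ⟨S, hS, hc⟩ := Subgroup.exists_right_transversal_of_le
      (show entD φ F ≤ F from inf_le_left)
    have hSc : Nat.card S = entI φ F := by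
      have h0 : 0 < Nat.card (entD φ F) := by
        have : Finite (entD φ F) := Set.Finite.subset hF (show entD φ F ≤ F from inf_le_left)
        exact Nat.card_pos
      exact Nat.eq_of_mul_eq_mul_left h0 (hc.trans (card_entD_mul φ F).symm)
    have hSF : S ⊆ F := by
      intro x hx
      rw [← hS]
      exact Set.mem_mul.2 ⟨1, (entD φ F).one_mem, x, hx, one_mul x⟩
    have hSfin : S.Finite := hF.subset hSF
    have key : entTraj φ (F : Set G) (n+1+1) ⊆
        entTraj φ (F : Set G) (n+1) * ((⇑φ)^[n+1] '' S) := by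
      rintro _ ⟨a, ⟨b, hb, _, ⟨f, hf, rfl⟩, rfl⟩, _, ⟨g, hg, rfl⟩, rfl⟩
      rw [← hS] at hg
      obtain ⟨u, hu, r, hr, rfl⟩ := hg
      refine Set.mem_mul.2 ⟨b * (⇑φ)^[n] (f * φ u), ?_, (⇑φ)^[n+1] r, ⟨r, hr, rfl⟩, ?_⟩
      · exact Set.mul_mem_mul hb ⟨_, F.mul_mem hf hu.2, rfl⟩
      · simp only [iterate_map_mul, Function.iterate_succ_apply, map_mul, mul_assoc]
    calc _ ≤ (entTraj φ (F : Set G) (n+1) * ((⇑φ)^[n+1] '' S)).ncard :=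
          Set.ncard_le_ncard key ((entTraj_finite φ hF _).mul (hSfin.image _))
      _ ≤ (entTraj φ (F : Set G) (n+1)).ncard * ((⇑φ)^[n+1] '' S).ncard := Set.natCard_mul_le
      _ ≤ (Nat.card F * entI φ F ^ n) * entI φ F := by
          refine Nat.mul_le_mul ih ?_
          rw [← hSc]
          exact Set.ncard_image_le hSfin
      _ = _ := by ring

/-- counting in a central extension -/
lemma fiber_count (N : Subgroup G) [N.Normal] (X A : Set G) (Y : Set (G ⧸ N)) (hX : X.Finite)
    (hA : A ⊆ N) (hY : ∀ y ∈ Y, ∃ x ∈ X, (x : G ⧸ N) = y)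
    (hm : ∀ a ∈ A, ∀ x ∈ X, x * a ∈ X) : A.ncard * Y.ncard ≤ X.ncard := by
  classical
  choose! t ht ht' using hY
  rw [← Set.ncard_prod]
  refine Set.ncard_le_ncard_of_injOn (fun p => t p.2 * p.1) ?_ ?_ hX
  · rintro ⟨a, y⟩ ⟨ha, hy⟩
    exact hm a ha _ (ht y hy)
  · rintro ⟨a, y⟩ ⟨ha, hy⟩ ⟨b, z⟩ ⟨hb, hz⟩ h
    simp only at h ha hy hb hz
    have h1 : ((t y * a : G) : G ⧸ N) = ((t z * b : G) : G ⧸ N) := by rw [h]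
    rw [QuotientGroup.mk_mul_of_mem _ (hA ha), QuotientGroup.mk_mul_of_mem _ (hA hb),
      ht' y hy, ht' z hz] at h1
    subst h1
    exact Prod.ext (mul_left_cancel h) rfl

lemma center_iterate (φ : G ≃* G) {a : G} (ha : a ∈ Subgroup.center G) (n : ℕ) :
    (⇑φ.toMonoidHom)^[n] a ∈ Subgroup.center G := by
  induction n with
  | zero => exact ha
  | succ n ih =>
    rw [Function.iterate_succ_apply']
    exact center_le_comap_equiv φ ih

lemma entTraj_mul_central (φ : G ≃* G) (F A : Subgroup G) (hA : A ≤ Subgroup.center G)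
    (hAF : A ≤ F) (n : ℕ) :
    ∀ a ∈ entTraj φ.toMonoidHom (A : Set G) n, ∀ x ∈ entTraj φ.toMonoidHom (F : Set G) n,
      x * a ∈ entTraj φ.toMonoidHom (F : Set G) n := by
  induction n with
  | zero =>
    rintro a rfl x rfl
    exact Set.mem_singleton_iff.2 (mul_one _)
  | succ n ih =>
    rintro _ ⟨a, ha, _, ⟨b, hb, rfl⟩, rfl⟩ _ ⟨x, hx, _, ⟨y, hy, rfl⟩, rfl⟩
    refine Set.mem_mul.2 ⟨x * a, ih a ha x hx, (⇑φ.toMonoidHom)^[n] (y * b),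
      ⟨_, F.mul_mem hy (hAF hb), rfl⟩, ?_⟩
    have hac : a ∈ Subgroup.center G := by
      clear ih hx hb
      induction n generalizing a with
      | zero => rw [Set.mem_singleton_iff.1 ha]; exact one_mem _
      | succ n ih2 =>
        obtain ⟨c, hc, _, ⟨d, hd, rfl⟩, rfl⟩ := ha
        exact mul_mem (ih2 c hc) (center_iterate φ (hA hd) n)
    rw [iterate_map_mul]
    have := Subgroup.mem_center_iff.1 hac ((⇑φ.toMonoidHom)^[n] y)
    simp only [mul_assoc]
    rw [← mul_assoc a, ← this, mul_assoc]

lemma entTraj_map {H : Type*} [Group H] (φ : G →* G) (ψ : H →* H) (π : G →* H)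
    (hc : ∀ x, π (φ x) = ψ (π x)) (F : Set G) (n : ℕ) :
    entTraj ψ (π '' F) n = π '' entTraj φ F n := by
  have hi : ∀ n x, π ((⇑φ)^[n] x) = (⇑ψ)^[n] (π x) := by
    intro n x
    exact (Function.Semiconj.iterate_right (f := π) (ga := φ) (gb := ψ) hc n) x
  induction n with
  | zero => simp [entTraj]
  | succ n ih =>
    rw [entTraj, entTraj, ih, Set.image_mul, Set.image_image, Set.image_image]
    simp only [hi]

/-- good subgroups -/
def EntGood (φ : G →* G) (F : Subgroup G) : Prop :=
  (F : Set G).Finite ∧ ∀ n, entI φ F ^ n ≤ (entTraj φ (F : Set G) n).ncard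

/-- iterates as homomorphisms -/
def entIt (φ : G →* G) : ℕ → G →* G
  | 0 => MonoidHom.id G
  | n + 1 => φ.comp (entIt φ n)

lemma entIt_apply (φ : G →* G) (n : ℕ) (x : G) : entIt φ n x = (⇑φ)^[n] x := by
  induction n with
  | zero => rfl
  | succ n ih => rw [Function.iterate_succ_apply', ← ih]; rfl

/-- trajectory subgroups -/
def entV (φ : G →* G) (A : Subgroup G) : ℕ → Subgroup G
  | 0 => ⊥
  | n + 1 => entV φ A n ⊔ A.map (entIt φ n)

lemma closure_finite_central (htor : Monoid.IsTorsion G) (S : Set G) (hS : S.Finite)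
    (hSc : S ⊆ Subgroup.center G) : (Subgroup.closure S : Set G).Finite := by
  have hcl : Subgroup.closure S ≤ Subgroup.center G := (Subgroup.closure_le _).2 hSc
  letI : CommGroup (Subgroup.closure S) :=
    { (inferInstance : Group (Subgroup.closure S)) with
      mul_comm := fun x y => Subtype.ext (Subgroup.mem_center_iff.1 (hcl y.2) x) }
  have : Group.FG (Subgroup.closure S) :=
    (Group.fg_iff_subgroup_fg _).2 ((Subgroup.fg_iff _).2 ⟨S, rfl, hS⟩)
  have ht : Monoid.IsTorsion (Subgroup.closure S) := htor.subgroup _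
  have : Finite (Subgroup.closure S) :=
    CommGroup.finite_of_fg_torsion (Subgroup.closure S) ht
  exact this

lemma map_entIt_central (φ : G ≃* G) (A : Subgroup G) (hA : A ≤ Subgroup.center G) (n : ℕ) :
    A.map (entIt φ.toMonoidHom n) ≤ Subgroup.center G := by
  rintro _ ⟨a, ha, rfl⟩
  rw [entIt_apply]
  exact center_iterate φ (hA ha) n

lemma entV_central (φ : G ≃* G) (A : Subgroup G) (hA : A ≤ Subgroup.center G) (n : ℕ) :
    entV φ.toMonoidHom A n ≤ Subgroup.center G := by
  induction n with
  | zero => exact bot_le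
  | succ n ih => exact sup_le ih (map_entIt_central φ A hA n)

lemma coe_entV (φ : G ≃* G) (A : Subgroup G) (hA : A ≤ Subgroup.center G) (n : ℕ) :
    (entV φ.toMonoidHom A n : Set G) = entTraj φ.toMonoidHom (A : Set G) n := by
  induction n with
  | zero => rfl
  | succ n ih =>
    have := normal_of_le_center (map_entIt_central φ A hA n)
    rw [entV, entTraj, Subgroup.mul_normal, ih]
    congr 1
    ext x
    simp [entIt_apply]

lemma map_entV_le (φ : G →* G) (A : Subgroup G) (n : ℕ) :
    (entV φ A n).map φ ≤ entV φ A (n+1) := by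
  induction n with
  | zero => simp [entV]
  | succ n ih =>
    rw [entV, Subgroup.map_sup, Subgroup.map_map]
    exact sup_le_sup ih le_rfl

lemma exists_good_central (htor : Monoid.IsTorsion G) (φ : G ≃* G) (S : Set G) (hS : S.Finite)
    (hSc : S ⊆ Subgroup.center G) :
    ∃ A : Subgroup G, A ≤ Subgroup.center G ∧ S ⊆ A ∧ EntGood φ.toMonoidHom A := by
  set B := Subgroup.closure S with hB
  have hBf : (B : Set G).Finite := closure_finite_central htor S hS hSc
  have hBc : B ≤ Subgroup.center G := (Subgroup.closure_le _).2 hSc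
  set ψ := φ.toMonoidHom with hψ
  set V := entV ψ B with hV
  have hVf : ∀ n, (V n : Set G).Finite := fun n => by
    rw [hV, coe_entV φ B hBc]; exact entTraj_finite _ hBf n
  have hVs : ∀ n, V n ≤ V (n+1) := fun n => le_sup_left
  have hVm : Monotone V := monotone_nat_of_le_succ hVs
  obtain ⟨m, hm⟩ : ∃ m, ∀ k, (V m).relIndex (V (m+1)) ≤ (V k).relIndex (V (k+1)) := by
    let f := fun k => (V k).relIndex (V (k+1))
    exact ⟨Function.argmin f, fun k => Function.argmin_le f k⟩
  set r := (V m).relIndex (V (m+1)) with hr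
  have hgrow : ∀ n, r ^ n ≤ Nat.card (V (m+n)) := by
    intro n
    induction n with
    | zero =>
      have : Finite (V (m+0)) := hVf _
      rw [pow_zero]
      exact Nat.card_pos (α := V (m+0))
    | succ n ih =>
      have := Subgroup.relIndex_mul_relIndex ⊥ (V (m+n)) (V (m+n+1)) bot_le (hVs _)
      rw [Subgroup.relIndex_bot_left, Subgroup.relIndex_bot_left] at this
      rw [← add_assoc, ← this, pow_succ]
      exact Nat.mul_le_mul ih (hm _)
  refine ⟨V (m+1), entV_central φ B hBc _, ?_, hVf _, ?_⟩
  · have h1 : B ≤ V 1 := by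
      rw [hV, entV]
      refine le_trans ?_ le_sup_right
      rintro x hx
      exact ⟨x, hx, rfl⟩
    exact Subgroup.subset_closure.trans (h1.trans (hVm (by omega)))
  · intro n
    have hi : entI ψ (V (m+1)) ≤ r := by
      have hle : V m ≤ entD ψ (V (m+1)) :=
        le_inf (hVs m) (Subgroup.map_le_iff_le_comap.1 (map_entV_le ψ B m))
      refine Nat.le_of_dvd ?_ (Subgroup.relIndex_dvd_of_le_left _ hle)
      have := Subgroup.relIndex_mul_relIndex ⊥ (V m) (V (m+1)) bot_le (hVs _)
      rw [Subgroup.relIndex_bot_left, Subgroup.relIndex_bot_left] at this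
      have hf : Finite (V (m+1)) := hVf _
      have h2 : 0 < Nat.card (V (m+1)) := Nat.card_pos
      rw [← this] at h2
      exact Nat.pos_of_mul_pos_left h2
    refine (Nat.pow_le_pow_left hi n).trans ?_
    rcases n with _ | n
    · rw [pow_zero]
      exact entTraj_ncard_pos ψ (V (m+1)) (hVf _) 0
    · refine (hgrow (n+1)).trans ?_
      have hsub : ∀ n, (V (m+(n+1)) : Set G) ⊆ entTraj ψ (V (m+1) : Set G) (n+1) := by
        intro n
        induction n with
        | zero => simp [entTraj]
        | succ n ih =>
          have e : (V (m+(n+1+1)) : Set G) = V (m+(n+1)) * ((⇑ψ)^[m+(n+1)] '' (B : Set G)) := by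
            rw [hV, coe_entV φ B hBc, coe_entV φ B hBc]; rfl
          rw [e, entTraj]
          refine Set.mul_subset_mul ih ?_
          rintro _ ⟨b, hb, rfl⟩
          refine ⟨(⇑ψ)^[m] b, ?_, ?_⟩
          · refine (le_sup_right : B.map (entIt ψ m) ≤ V (m+1)) ⟨b, hb, entIt_apply _ _ _⟩
          · rw [← Function.iterate_add_apply, add_comm]
      exact Set.ncard_le_ncard (hsub n) (entTraj_finite ψ (hVf _) _)

lemma exists_good (n : ℕ) : ∀ {G : Type u} [Group G], Monoid.IsTorsion G → ∀ (φ : G ≃* G)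
    (F : Subgroup G), (F : Set G).Finite → F ≤ Subgroup.upperCentralSeries G n →
    ∃ F' : Subgroup G, F ≤ F' ∧ EntGood φ.toMonoidHom F' := by
  induction n with
  | zero =>
    intro G _ htor φ F hF hle
    refine ⟨F, le_rfl, hF, fun n => ?_⟩
    have hb : F = ⊥ := by
      rw [Subgroup.upperCentralSeries_zero] at hle
      exact le_bot_iff.1 hle
    have : entI φ.toMonoidHom F = 1 := by
      subst hb
      rw [entI]; simp
    rw [this, one_pow]
    exact entTraj_ncard_pos _ F hF n
  | succ n ih =>
    intro G _ htor φ F hF hle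
    let N := Subgroup.center G
    let π := QuotientGroup.mk' N
    let φ' : G ⧸ N ≃* G ⧸ N := QuotientGroup.congr N N φ
      (Subgroup.characteristic_iff_map_eq.1 inferInstance φ)
    have hφ' : ∀ x : G, φ' (x : G ⧸ N) = ((φ x : G) : G ⧸ N) := fun x => rfl
    obtain ⟨K, hFK, hKf, hK⟩ := ih (G := G ⧸ N)
      (IsMulTorsion.of_surjective (QuotientGroup.mk'_surjective N) htor) φ' (F.map π)
      (by rw [Subgroup.coe_map]; exact hF.image _)
      (by
        rw [Subgroup.map_le_iff_le_comap, Subgroup.comap_upperCentralSeries_quotient_center]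
        exact hle)
    let s : G ⧸ N → G := Quotient.out
    have hs : ∀ x, ((s x : G) : G ⧸ N) = x := fun x => Quotient.out_eq' x
    have hN : ∀ x y : G, (x : G ⧸ N) = y → x⁻¹ * y ∈ N := fun x y h => QuotientGroup.eq.1 h
    let S1 : Set G := (fun p : (G ⧸ N) × (G ⧸ N) => (s (p.1 * p.2))⁻¹ * (s p.1 * s p.2)) '' ((K : Set (G ⧸ N)) ×ˢ (K : Set (G ⧸ N)))
    let S2 : Set G := (fun f : G => (s (f : G ⧸ N))⁻¹ * f) '' (F : Set G)
    let S3 : Set G := (fun x : G ⧸ N => (s x)⁻¹ * φ.symm (s (φ' x))) '' (K : Set (G ⧸ N))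
    let S4 : Set G := (fun x : G ⧸ N => (s x⁻¹)⁻¹ * (s x)⁻¹) '' (K : Set (G ⧸ N))
    obtain ⟨A, hAN, hSA, hAf, hA⟩ := exists_good_central htor φ ((S1 ∪ S2) ∪ (S3 ∪ S4))
      ((((hKf.prod hKf).image _).union (hF.image _)).union ((hKf.image _).union (hKf.image _)))
      (by
        rintro _ ((⟨p, _, rfl⟩ | ⟨f, _, rfl⟩) | (⟨x, _, rfl⟩ | ⟨x, _, rfl⟩))
        · apply hN
          rw [hs, QuotientGroup.mk_mul, hs, hs]
        · apply hN
          rw [hs]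
        · apply hN
          rw [hs]
          apply φ'.injective
          rw [hφ', φ.apply_symm_apply, hs]
        · apply hN
          rw [hs, QuotientGroup.mk_inv, hs])
    have hcomm : ∀ a ∈ A, ∀ g : G, g * a = a * g := fun a ha g =>
      Subgroup.mem_center_iff.1 (hAN ha) g
    have hmkA : ∀ a ∈ A, (a : G ⧸ N) = 1 := fun a ha =>
      (QuotientGroup.eq_one_iff a).2 (hAN ha)
    -- membership description
    have hS1 : ∀ x ∈ K, ∀ y ∈ K, (s (x * y))⁻¹ * (s x * s y) ∈ A := fun x hx y hy =>
      hSA (Or.inl (Or.inl ⟨(x, y), ⟨hx, hy⟩, rfl⟩))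
    have hS2 : ∀ f ∈ F, (s (f : G ⧸ N))⁻¹ * f ∈ A := fun f hf =>
      hSA (Or.inl (Or.inr ⟨f, hf, rfl⟩))
    have hS3 : ∀ x ∈ K, (s x)⁻¹ * φ.symm (s (φ' x)) ∈ A := fun x hx =>
      hSA (Or.inr (Or.inl ⟨x, hx, rfl⟩))
    have hS4 : ∀ x ∈ K, (s x⁻¹)⁻¹ * (s x)⁻¹ ∈ A := fun x hx =>
      hSA (Or.inr (Or.inr ⟨x, hx, rfl⟩))
    let F' : Subgroup G :=
      { carrier := {g | (g : G ⧸ N) ∈ K ∧ (s (g : G ⧸ N))⁻¹ * g ∈ A}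
        mul_mem' := by
          rintro g h ⟨hg, hg'⟩ ⟨hh, hh'⟩
          refine ⟨K.mul_mem hg hh, ?_⟩
          have h1 := A.mul_mem (A.mul_mem (hS1 _ hg _ hh) hg') hh'
          have h2 := hcomm _ hg' (s (h : G ⧸ N))
          convert h1 using 1
          rw [QuotientGroup.mk_mul]
          set a := (s (g : G ⧸ N))⁻¹ * g with ha
          have hga : g = s (g : G ⧸ N) * a := by rw [ha]; group
          calc _ = (s ((g : G ⧸ N) * (h : G ⧸ N)))⁻¹ * (s (g : G ⧸ N) * a * h) := by rw [← hga]
            _ = (s ((g : G ⧸ N) * (h : G ⧸ N)))⁻¹ * s (g : G ⧸ N) * (a * s (h : G ⧸ N)) *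
                  ((s (h : G ⧸ N))⁻¹ * h) := by group
            _ = _ := by rw [← h2]; group
        one_mem' := by
          refine ⟨K.one_mem, ?_⟩
          have := hS2 1 F.one_mem
          exact this
        inv_mem' := by
          rintro g ⟨hg, hg'⟩
          refine ⟨K.inv_mem hg, ?_⟩
          have h1 := A.mul_mem (hS4 _ hg) (A.inv_mem hg')
          convert h1 using 1
          have h2 := hcomm _ (A.inv_mem hg') (s (g : G ⧸ N))⁻¹
          rw [mul_assoc, h2, QuotientGroup.mk_inv]
          group }
    have hmemF' : ∀ g, g ∈ F' ↔ ((g : G ⧸ N) ∈ K ∧ (s (g : G ⧸ N))⁻¹ * g ∈ A) := fun g => Iff.rfl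
    have hAF' : A ≤ F' := by
      intro a ha
      rw [hmemF', hmkA a ha]
      refine ⟨K.one_mem, A.mul_mem ?_ ha⟩
      have := hS2 1 F.one_mem
      simpa using this
    have hsF' : ∀ x ∈ K, s x ∈ F' := by
      intro x hx
      rw [hmemF', hs, inv_mul_cancel]
      exact ⟨hx, A.one_mem⟩
    have hF'map : (⇑π) '' (F' : Set G) = (K : Set (G ⧸ N)) := by
      ext x
      constructor
      · rintro ⟨g, hg, rfl⟩
        exact hg.1
      · intro hx
        exact ⟨s x, hsF' x hx, hs x⟩
    have hinj : Set.InjOn (fun g : G => ((g : G ⧸ N), (s (g : G ⧸ N))⁻¹ * g)) (F' : Set G) := by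
      intro g _ h _ hgh
      simp only [Prod.mk.injEq] at hgh
      obtain ⟨h1, h2⟩ := hgh
      rw [h1] at h2
      exact mul_left_cancel h2
    have hmaps : Set.MapsTo (fun g : G => ((g : G ⧸ N), (s (g : G ⧸ N))⁻¹ * g)) (F' : Set G)
        ((K : Set (G ⧸ N)) ×ˢ (A : Set G)) := fun g hg => hg
    have hF'f : (F' : Set G).Finite := Set.Finite.of_injOn hmaps hinj (hKf.prod hAf)
    have hcard : Nat.card F' ≤ Nat.card K * Nat.card A := by
      have := Set.ncard_le_ncard_of_injOn _ hmaps hinj (hKf.prod hAf)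
      rw [Set.ncard_prod] at this
      exact this
    have hD : Nat.card (entD φ.toMonoidHom A) * Nat.card (entD φ'.toMonoidHom K) ≤
        Nat.card (entD φ.toMonoidHom F') := by
      refine fiber_count N (entD φ.toMonoidHom F' : Set G) (entD φ.toMonoidHom A : Set G)
        (entD φ'.toMonoidHom K : Set (G ⧸ N)) (hF'f.subset (fun x hx => hx.1))
        (fun x hx => hAN hx.1) ?_ ?_
      · rintro x ⟨hx, hx'⟩
        have hx2 : φ' x ∈ K := hx'
        have e : ((φ.symm (s (φ' x)) : G) : G ⧸ N) = x := by
          apply φ'.injective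
          rw [hφ', φ.apply_symm_apply, hs]
        refine ⟨φ.symm (s (φ' x)), ⟨?_, ?_⟩, e⟩
        · refine (hmemF' _).2 ⟨?_, ?_⟩
          · rw [e]; exact hx
          · rw [e]; exact hS3 x hx
        · show φ (φ.symm (s (φ' x))) ∈ F'
          rw [φ.apply_symm_apply]
          exact hsF' _ hx2
      · intro a ha x hx
        exact mul_mem hx ⟨hAF' ha.1, hAF' ha.2⟩
    have hI : entI φ.toMonoidHom F' ≤ entI φ.toMonoidHom A * entI φ'.toMonoidHom K := by
      have h1 := card_entD_mul φ.toMonoidHom F'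
      have h2 := card_entD_mul φ.toMonoidHom A
      have h3 := card_entD_mul φ'.toMonoidHom K
      have hpos : 0 < Nat.card (entD φ.toMonoidHom F') := by
        have : Finite (entD φ.toMonoidHom F') := hF'f.subset (fun x hx => hx.1)
        exact Nat.card_pos
      refine Nat.le_of_mul_le_mul_left ?_ hpos
      rw [h1]
      refine hcard.trans ?_
      rw [← h2, ← h3]
      calc _ = (Nat.card (entD φ.toMonoidHom A) * Nat.card (entD φ'.toMonoidHom K)) *
            (entI φ.toMonoidHom A * entI φ'.toMonoidHom K) := by ring
        _ ≤ _ := Nat.mul_le_mul_right _ hD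
    refine ⟨F', ?_, hF'f, ?_⟩
    · intro f hf
      exact (hmemF' f).2 ⟨hFK ⟨f, hf, rfl⟩, hS2 f hf⟩
    · intro n
      refine (Nat.pow_le_pow_left hI n).trans ?_
      rw [mul_pow]
      refine (Nat.mul_le_mul (hA n) (hK n)).trans ?_
      refine fiber_count N _ _ _ (entTraj_finite _ hF'f n) ?_ ?_
        (entTraj_mul_central φ F' A hAN hAF' n)
      · rw [← coe_entV φ A hAN]
        exact entV_central φ A hAN n
      · rw [← hF'map, entTraj_map φ.toMonoidHom φ'.toMonoidHom π (fun x => rfl)]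
        rintro _ ⟨x, hx, rfl⟩
        exact ⟨x, hx, rfl⟩

lemma tendsto_aux (a c : ℝ) :
    Filter.Tendsto (fun n : ℕ => c / n + a) Filter.atTop (nhds a) := by
  simpa using (tendsto_const_div_atTop_nhds_zero_nat c).add_const a

lemma traj_log_le (φ : G →* G) (F F' : Subgroup G) (h : F ≤ F') (hF' : (F' : Set G).Finite)
    (n : ℕ) (hn : 1 ≤ n) :
    Real.log (entTraj φ (F : Set G) n).ncard / n ≤
      Real.log (Nat.card F') / n + Real.log (entI φ F') := by
  have hpos : (0 : ℝ) < n := by exact_mod_cast hn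
  have hfin : Finite F' := hF'
  have hi := entI_pos φ F' hF'
  have h1 : (entTraj φ (F : Set G) n).ncard ≤ Nat.card F' * entI φ F' ^ n := by
    obtain ⟨k, rfl⟩ : ∃ k, n = k + 1 := ⟨n - 1, by omega⟩
    refine (Set.ncard_le_ncard (entTraj_mono φ h _) (entTraj_finite φ hF' _)).trans ?_
    refine (entTraj_upper φ F' hF' k).trans ?_
    exact Nat.mul_le_mul_left _ (Nat.pow_le_pow_right hi (Nat.le_succ k))
  have h0 := entTraj_ncard_pos φ F (hF'.subset h) n
  have h2 : Real.log (entTraj φ (F : Set G) n).ncard ≤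
      Real.log (Nat.card F') + n * Real.log (entI φ F') := by
    have hc : (0:ℝ) < Nat.card F' := by exact_mod_cast Nat.card_pos
    have hi' : (0:ℝ) < entI φ F' := by exact_mod_cast hi
    rw [← Real.log_pow, ← Real.log_mul hc.ne' (pow_pos hi' n).ne']
    exact Real.log_le_log (by exact_mod_cast h0) (by exact_mod_cast h1)
  calc _ ≤ (Real.log (Nat.card F') + n * Real.log (entI φ F')) / n := by gcongr
    _ = _ := by field_simp

lemma entH_le (φ : G →* G) (F F' : Subgroup G) (h : F ≤ F') (hF' : (F' : Set G).Finite) :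
    entH φ F ≤ Real.log (entI φ F') := by
  have ht := tendsto_aux (Real.log (entI φ F')) (Real.log (Nat.card F'))
  rw [← ht.limsup_eq]
  refine Filter.limsup_le_limsup ?_ ?_ ht.isBoundedUnder_le
  · filter_upwards [Filter.eventually_ge_atTop 1] with n hn
    exact traj_log_le φ F F' h hF' n hn
  · refine Filter.IsBoundedUnder.isCoboundedUnder_le ⟨0, ?_⟩
    refine Filter.eventually_map.2 (Filter.Eventually.of_forall fun n => ?_)
    exact div_nonneg (Real.log_natCast_nonneg _) (Nat.cast_nonneg n)

lemma entH_good (φ : G →* G) (F : Subgroup G) (hF : EntGood φ F) :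
    entH φ F = Real.log (entI φ F) := by
  have ht := tendsto_aux (Real.log (entI φ F)) (Real.log (Nat.card F))
  refine Filter.Tendsto.limsup_eq ?_
  refine tendsto_of_tendsto_of_tendsto_of_le_of_le' tendsto_const_nhds ht ?_ ?_
  · filter_upwards [Filter.eventually_ge_atTop 1] with n hn
    have hpos : (0 : ℝ) < n := by exact_mod_cast hn
    rw [le_div_iff₀ hpos, mul_comm, ← Real.log_pow]
    have hi' : (0:ℝ) < entI φ F := by exact_mod_cast entI_pos φ F hF.1
    exact Real.log_le_log (pow_pos hi' n) (by exact_mod_cast hF.2 n)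
  · filter_upwards [Filter.eventually_ge_atTop 1] with n hn
    exact traj_log_le φ F F le_rfl hF.1 n hn

lemma exists_ucs_bound (hhyp : ∀ g : G, ∃ n : ℕ, g ∈ Subgroup.upperCentralSeries G n)
    (F : Subgroup G) (hF : (F : Set G).Finite) :
    ∃ n, F ≤ Subgroup.upperCentralSeries G n := by
  choose f hf using hhyp
  obtain ⟨n, hn⟩ := (hF.image f).bddAbove
  exact ⟨n, fun g hg => Subgroup.upperCentralSeries_mono G (hn ⟨g, hg, rfl⟩) (hf g)⟩

end Helpers

end AlgEntropy

/-- Let `G` be a torsion `ω`-hypercentral group (that is, a torsion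
group with `G = ⋃_n Z_n(G)`) and let `φ` be an automorphism of `G`. Then either
`h(φ) = ∞` or `h(φ) = log α` for some positive integer `α`. -/
theorem algEnt_dichotomy_omega_hypercentral {G : Type*} [Group G]
    (htor : Monoid.IsTorsion G)
    (hhyp : ∀ g : G, ∃ n : ℕ, g ∈ upperCentralSeries G n)
    (φ : G ≃* G) :
    AlgEntropy.algEnt φ.toMonoidHom = ⊤ ∨
      ∃ α : ℕ+, AlgEntropy.algEnt φ.toMonoidHom = ENNReal.ofReal (Real.log α) := by
  have hgood : ∀ F : Subgroup G, (F : Set G).Finite →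
      ∃ F' : Subgroup G, F ≤ F' ∧ AlgEntropy.EntGood φ.toMonoidHom F' := by
    intro F hF
    obtain ⟨n, hn⟩ := AlgEntropy.exists_ucs_bound hhyp F hF
    exact AlgEntropy.exists_good n htor φ F hF hn
  have hlow : ∀ F : Subgroup G, AlgEntropy.EntGood φ.toMonoidHom F →
      ENNReal.ofReal (Real.log (AlgEntropy.entI φ.toMonoidHom F)) ≤
        AlgEntropy.algEnt φ.toMonoidHom := by
    intro F hF
    rw [← AlgEntropy.entH_good _ F hF]
    exact le_iSup₂_of_le F hF.1 le_rfl
  let S : Set ℕ := {k | ∃ F : Subgroup G, AlgEntropy.EntGood φ.toMonoidHom F ∧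
    AlgEntropy.entI φ.toMonoidHom F = k}
  have hne : S.Nonempty := by
    obtain ⟨F', -, hF'⟩ := hgood ⊥ (by simp)
    exact ⟨_, F', hF', rfl⟩
  by_cases hb : BddAbove S
  · right
    obtain ⟨F, hF, hFe⟩ := Nat.sSup_mem hne hb
    have hpos := AlgEntropy.entI_pos φ.toMonoidHom F hF.1
    refine ⟨⟨AlgEntropy.entI φ.toMonoidHom F, hpos⟩, le_antisymm ?_ (hlow F hF)⟩
    refine iSup₂_le fun K hK => ?_
    obtain ⟨K', hKK', hK'⟩ := hgood K hK
    refine ENNReal.ofReal_le_ofReal ?_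
    refine (AlgEntropy.entH_le _ K K' hKK' hK'.1).trans ?_
    have hp := AlgEntropy.entI_pos φ.toMonoidHom K' hK'.1
    refine Real.log_le_log (by exact_mod_cast hp) ?_
    have : AlgEntropy.entI φ.toMonoidHom K' ≤ AlgEntropy.entI φ.toMonoidHom F := by
      rw [hFe]; exact le_csSup hb ⟨K', hK', rfl⟩
    exact_mod_cast this
  · left
    refine ENNReal.eq_top_of_forall_nnreal_le fun r => ?_
    rw [not_bddAbove_iff] at hb
    obtain ⟨k, ⟨F, hF, rfl⟩, hk⟩ := hb ⌈Real.exp r⌉₊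
    refine le_trans ?_ (hlow F hF)
    rw [← ENNReal.ofReal_coe_nnreal]
    refine ENNReal.ofReal_le_ofReal ?_
    have h1 : Real.exp r ≤ (AlgEntropy.entI φ.toMonoidHom F : ℝ) :=
      (Nat.le_ceil _).trans (by exact_mod_cast hk.le)
    rw [Real.le_log_iff_exp_le (lt_of_lt_of_le (Real.exp_pos _) h1)]
    exact h1
end
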